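/- arXiv:2104.08596 — 6 statements merged into one kernel-verified Lean document; each statement's English description precedes it below -/
import Mathlib

section
/- For every real ν and every x > 0, the Bateman function k_ν is twice differentiable at x and satisfies the ordinary differential equation x·k_ν''(x) = (x − ν)·k_ν(x). -/
/-- The Bateman function `k_ν(x) = (2/π) ∫₀^{π/2} cos(x·tan θ − ν·θ) dθ`. -/
noncomputable def batemanK (ν x : ℝ) : ℝ :=
  (2 / Real.pi) * ∫ θ in (0:ℝ)..(Real.pi / 2), Real.cos (x * Real.tan θ - ν * θ)

open Set Filter Topology MeasureTheory

section Truncated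

variable {b : ℝ}

lemma cos_pos_of_mem_uIcc (hb0 : 0 ≤ b) (hb : b < Real.pi / 2) {θ : ℝ} (hθ : θ ∈ uIcc 0 b) :
    0 < Real.cos θ := by
  rw [uIcc_of_le hb0] at hθ
  exact Real.cos_pos_of_mem_Ioo ⟨by linarith [hθ.1, Real.pi_pos], by linarith [hθ.2]⟩

lemma continuousOn_tan_uIcc (hb0 : 0 ≤ b) (hb : b < Real.pi / 2) :
    ContinuousOn Real.tan (uIcc 0 b) := fun _ hθ =>
  (Real.continuousAt_tan.2 (cos_pos_of_mem_uIcc hb0 hb hθ).ne').continuousWithinAt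

/-- Differentiation under the integral sign of the truncated Bateman integral. -/
lemma hasDerivAt_truncated_cos (ν x : ℝ) (hb0 : 0 ≤ b) (hb : b < Real.pi / 2) :
    HasDerivAt (fun y => ∫ θ in (0:ℝ)..b, Real.cos (y * Real.tan θ - ν * θ))
      (∫ θ in (0:ℝ)..b, -(Real.tan θ * Real.sin (x * Real.tan θ - ν * θ))) x := by
  have ht := continuousOn_tan_uIcc hb0 hb
  refine (intervalIntegral.hasDerivAt_integral_of_dominated_loc_of_deriv_le
    (F := fun y θ => Real.cos (y * Real.tan θ - ν * θ))
    (F' := fun y θ => -(Real.tan θ * Real.sin (y * Real.tan θ - ν * θ)))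
    (bound := fun θ => |Real.tan θ|) (s := univ) univ_mem ?_ ?_ ?_ ?_ ?_ ?_).2
  · refine Eventually.of_forall fun y => ?_
    exact (ContinuousOn.mono (by fun_prop) uIoc_subset_uIcc).aestronglyMeasurable measurableSet_uIoc
  · exact ContinuousOn.intervalIntegrable (by fun_prop)
  · exact (ContinuousOn.mono (by fun_prop) uIoc_subset_uIcc).aestronglyMeasurable measurableSet_uIoc
  · refine Eventually.of_forall fun θ _ y _ => ?_
    rw [norm_neg, norm_mul, Real.norm_eq_abs, Real.norm_eq_abs]
    exact mul_le_of_le_one_right (abs_nonneg _) (Real.abs_sin_le_one _)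
  · exact ht.abs.intervalIntegrable
  · refine Eventually.of_forall fun θ _ y _ => ?_
    have h := (((hasDerivAt_id y).mul_const (Real.tan θ)).sub_const (ν * θ)).cos
    refine h.congr_deriv ?_
    simp only [id]; ring

lemma hasDerivAt_truncated_tan_mul_sin (ν x : ℝ) (hb0 : 0 ≤ b) (hb : b < Real.pi / 2) :
    HasDerivAt (fun y => ∫ θ in (0:ℝ)..b, -(Real.tan θ * Real.sin (y * Real.tan θ - ν * θ)))
      (∫ θ in (0:ℝ)..b, -(Real.tan θ ^ 2 * Real.cos (x * Real.tan θ - ν * θ))) x := by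
  have ht := continuousOn_tan_uIcc hb0 hb
  refine (intervalIntegral.hasDerivAt_integral_of_dominated_loc_of_deriv_le
    (F := fun y θ => -(Real.tan θ * Real.sin (y * Real.tan θ - ν * θ)))
    (F' := fun y θ => -(Real.tan θ ^ 2 * Real.cos (y * Real.tan θ - ν * θ)))
    (bound := fun θ => |Real.tan θ ^ 2|) (s := univ) univ_mem ?_ ?_ ?_ ?_ ?_ ?_).2
  · refine Eventually.of_forall fun y => ?_
    exact (ContinuousOn.mono (by fun_prop) uIoc_subset_uIcc).aestronglyMeasurable measurableSet_uIoc
  · exact ContinuousOn.intervalIntegrable (by fun_prop)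
  · exact (ContinuousOn.mono (by fun_prop) uIoc_subset_uIcc).aestronglyMeasurable measurableSet_uIoc
  · refine Eventually.of_forall fun θ _ y _ => ?_
    rw [norm_neg, norm_mul, Real.norm_eq_abs, Real.norm_eq_abs]
    exact mul_le_of_le_one_right (abs_nonneg _) (Real.abs_cos_le_one _)
  · exact (ht.pow 2).abs.intervalIntegrable
  · refine Eventually.of_forall fun θ _ y _ => ?_
    have h := (((((hasDerivAt_id y).mul_const (Real.tan θ)).sub_const (ν * θ)).sin).const_mul
      (Real.tan θ)).neg
    refine h.congr_deriv ?_
    simp only [id]; ring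

lemma hasDerivAt_phase (ν x : ℝ) {θ : ℝ} (hθ : Real.cos θ ≠ 0) :
    HasDerivAt (fun θ => x * Real.tan θ - ν * θ) (x / Real.cos θ ^ 2 - ν) θ := by
  have h := ((Real.hasDerivAt_tan hθ).const_mul x).sub ((hasDerivAt_id θ).const_mul ν)
  refine h.congr_deriv ?_
  ring

/-- The bounded integrand that represents `-x` times the derivative of the Bateman integral. -/
noncomputable def batemanDerivIntegrand (ν x θ : ℝ) : ℝ :=
  (Real.cos θ ^ 2 - Real.sin θ ^ 2) * Real.cos (x * Real.tan θ - ν * θ)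
    + ν * (Real.sin θ * Real.cos θ) * Real.sin (x * Real.tan θ - ν * θ)

/-- Integration by parts for the first derivative of the truncated integral. -/
lemma mul_truncated_tan_mul_sin (ν x : ℝ) (hb0 : 0 ≤ b) (hb : b < Real.pi / 2) :
    x * (∫ θ in (0:ℝ)..b, -(Real.tan θ * Real.sin (x * Real.tan θ - ν * θ)))
      = Real.sin b * Real.cos b * Real.cos (x * Real.tan b - ν * b)
        - ∫ θ in (0:ℝ)..b, batemanDerivIntegrand ν x θ := by
  have ht := continuousOn_tan_uIcc hb0 hb
  have hJ : IntervalIntegrable (batemanDerivIntegrand ν x) volume 0 b := by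
    refine ContinuousOn.intervalIntegrable ?_
    unfold batemanDerivIntegrand
    fun_prop
  have hI : IntervalIntegrable
      (fun θ => x * -(Real.tan θ * Real.sin (x * Real.tan θ - ν * θ))) volume 0 b :=
    ContinuousOn.intervalIntegrable (by fun_prop)
  have h := intervalIntegral.integral_eq_sub_of_hasDerivAt
    (f := fun θ => Real.sin θ * Real.cos θ * Real.cos (x * Real.tan θ - ν * θ))
    (f' := fun θ => x * -(Real.tan θ * Real.sin (x * Real.tan θ - ν * θ))
      + batemanDerivIntegrand ν x θ) (a := 0) (b := b) ?_ (hI.add hJ)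
  · rw [intervalIntegral.integral_add hI hJ, intervalIntegral.integral_const_mul] at h
    simp only [Real.sin_zero, zero_mul, sub_zero] at h
    linarith
  · intro θ hθ
    have hc := (cos_pos_of_mem_uIcc hb0 hb hθ).ne'
    have h := ((Real.hasDerivAt_sin θ).mul (Real.hasDerivAt_cos θ)).mul
      (hasDerivAt_phase ν x hc).cos
    refine h.congr_deriv ?_
    simp only [batemanDerivIntegrand, Pi.mul_apply]
    generalize Real.sin (x * Real.tan θ - ν * θ) = S
    generalize Real.cos (x * Real.tan θ - ν * θ) = C
    rw [Real.tan_eq_sin_div_cos]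
    field_simp
    ring

lemma mul_truncated_tan_sq_mul_cos (ν x : ℝ) (hb0 : 0 ≤ b) (hb : b < Real.pi / 2) :
    x * (∫ θ in (0:ℝ)..b, -(Real.tan θ ^ 2 * Real.cos (x * Real.tan θ - ν * θ)))
      = (x - ν) * (∫ θ in (0:ℝ)..b, Real.cos (x * Real.tan θ - ν * θ))
        - Real.sin (x * Real.tan b - ν * b) := by
  have ht := continuousOn_tan_uIcc hb0 hb
  have hJ : IntervalIntegrable
      (fun θ => (x - ν) * Real.cos (x * Real.tan θ - ν * θ)) volume 0 b :=
    ContinuousOn.intervalIntegrable (by fun_prop)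
  have hI : IntervalIntegrable
      (fun θ => x * -(Real.tan θ ^ 2 * Real.cos (x * Real.tan θ - ν * θ))) volume 0 b :=
    ContinuousOn.intervalIntegrable (by fun_prop)
  have h := intervalIntegral.integral_eq_sub_of_hasDerivAt
    (f := fun θ => Real.sin (x * Real.tan θ - ν * θ))
    (f' := fun θ => (x - ν) * Real.cos (x * Real.tan θ - ν * θ)
      - x * -(Real.tan θ ^ 2 * Real.cos (x * Real.tan θ - ν * θ)))
    (a := 0) (b := b) ?_ (hJ.sub hI)
  · rw [intervalIntegral.integral_sub hJ hI, intervalIntegral.integral_const_mul,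
      intervalIntegral.integral_const_mul] at h
    simp only [Real.tan_zero, mul_zero, sub_zero, Real.sin_zero] at h
    linarith
  · intro θ hθ
    have hc := (cos_pos_of_mem_uIcc hb0 hb hθ).ne'
    refine (hasDerivAt_phase ν x hc).sin.congr_deriv ?_
    generalize Real.cos (x * Real.tan θ - ν * θ) = C
    rw [Real.tan_eq_sin_div_cos]
    field_simp
    rw [Real.sin_sq]
    ring

end Truncated

section Limits

lemma measurable_real_tan : Measurable Real.tan := by
  have : Real.tan = fun x => Real.sin x / Real.cos x := funext Real.tan_eq_sin_div_cos
  rw [this]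
  exact Real.measurable_sin.div Real.measurable_cos

/-- A bounded measurable integrand has truncated integrals close to the full one. -/
lemma abs_truncated_integral_sub_le {f : ℝ → ℝ} (hf : Measurable f) {C : ℝ}
    (hC : ∀ θ, |f θ| ≤ C) (a b c : ℝ) :
    |(∫ θ in a..c, f θ) - ∫ θ in a..b, f θ| ≤ C * |c - b| := by
  have hi : ∀ u v, IntervalIntegrable f volume u v := fun u v =>
    (intervalIntegrable_const (c := C)).mono_fun hf.aestronglyMeasurable
      (Eventually.of_forall fun θ => (hC θ).trans (le_abs_self C))
  rw [intervalIntegral.integral_interval_sub_left (hi _ _) (hi _ _)]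
  exact intervalIntegral.norm_integral_le_of_norm_le_const (f := f) fun θ _ => hC θ

lemma abs_batemanDerivIntegrand_le (ν x θ : ℝ) : |batemanDerivIntegrand ν x θ| ≤ 1 + |ν| := by
  have h1 : |Real.cos θ ^ 2 - Real.sin θ ^ 2| ≤ 1 := by
    rw [← Real.cos_two_mul']; exact Real.abs_cos_le_one _
  have h2 : |Real.sin θ * Real.cos θ| ≤ 1 := by
    rw [abs_mul]
    exact mul_le_one₀ (Real.abs_sin_le_one _) (abs_nonneg _) (Real.abs_cos_le_one _)
  refine (abs_add_le _ _).trans (add_le_add ?_ ?_)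
  · rw [abs_mul]
    exact mul_le_one₀ h1 (abs_nonneg _) (Real.abs_cos_le_one _)
  · rw [abs_mul, abs_mul, mul_assoc]
    exact mul_le_of_le_one_right (abs_nonneg _)
      (mul_le_one₀ h2 (abs_nonneg _) (Real.abs_sin_le_one _))

lemma measurable_batemanDerivIntegrand (ν x : ℝ) : Measurable (batemanDerivIntegrand ν x) := by
  have := measurable_real_tan
  unfold batemanDerivIntegrand
  fun_prop

lemma measurable_bateman_integrand (ν x : ℝ) :
    Measurable fun θ => Real.cos (x * Real.tan θ - ν * θ) := by
  have := measurable_real_tan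
  fun_prop

lemma eventually_mem_Ico_pi_div_two :
    ∀ᶠ b in 𝓝[<] (Real.pi / 2), 0 ≤ b ∧ b < Real.pi / 2 := by
  filter_upwards [Ioo_mem_nhdsLT Real.pi_div_two_pos] with b hb
  exact ⟨hb.1.le, hb.2⟩

lemma tendsto_abs_pi_div_two_sub :
    Tendsto (fun b => |Real.pi / 2 - b|) (𝓝[<] (Real.pi / 2)) (𝓝 0) := by
  have h : Continuous fun b => |Real.pi / 2 - b| := by fun_prop
  simpa using (h.tendsto (Real.pi / 2)).mono_left nhdsWithin_le_nhds

lemma tendsto_abs_cos_pi_div_two :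
    Tendsto (fun b => |Real.cos b|) (𝓝[<] (Real.pi / 2)) (𝓝 0) := by
  have h : Continuous fun b => |Real.cos b| := by fun_prop
  simpa using (h.tendsto (Real.pi / 2)).mono_left nhdsWithin_le_nhds

lemma tendstoUniformlyOn_of_eventually_abs_sub_le {ι : Type*} {l : Filter ι} {F : ι → ℝ → ℝ}
    {f : ℝ → ℝ} {s : Set ℝ} {c : ι → ℝ} (hc : Tendsto c l (𝓝 0))
    (h : ∀ᶠ i in l, ∀ y ∈ s, |f y - F i y| ≤ c i) : TendstoUniformlyOn F f l s := by
  rw [Metric.tendstoUniformlyOn_iff]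
  intro ε hε
  filter_upwards [h, hc.eventually_lt_const hε] with i hi hci y hy
  exact (hi y hy).trans_lt hci

lemma hasDerivAt_bateman_integral (ν : ℝ) {x : ℝ} (hx : 0 < x) :
    HasDerivAt (fun y => ∫ θ in (0:ℝ)..(Real.pi / 2), Real.cos (y * Real.tan θ - ν * θ))
      (-(∫ θ in (0:ℝ)..(Real.pi / 2), batemanDerivIntegrand ν x θ) / x) x := by
  have hδ : 0 < x / 2 := by linarith
  refine hasDerivAt_of_tendstoUniformlyOn (l := 𝓝[<] (Real.pi / 2)) (s := Ioi (x / 2))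
    (f := fun b y => ∫ θ in (0:ℝ)..b, Real.cos (y * Real.tan θ - ν * θ))
    (f' := fun b y => ∫ θ in (0:ℝ)..b, -(Real.tan θ * Real.sin (y * Real.tan θ - ν * θ)))
    (g' := fun y => -(∫ θ in (0:ℝ)..(Real.pi / 2), batemanDerivIntegrand ν y θ) / y)
    isOpen_Ioi ?_ ?_ ?_ (show x / 2 < x by linarith)
  · refine tendstoUniformlyOn_of_eventually_abs_sub_le
      (c := fun b => ((1 + |ν|) * |Real.pi / 2 - b| + |Real.cos b|) / (x / 2)) ?_ ?_
    · simpa using ((tendsto_abs_pi_div_two_sub.const_mul (1 + |ν|)).add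
        tendsto_abs_cos_pi_div_two).div_const (x / 2)
    · filter_upwards [eventually_mem_Ico_pi_div_two] with b hb y hy
      have hy0 : 0 < y := hδ.trans hy
      have h1 := mul_truncated_tan_mul_sin ν y hb.1 hb.2
      have h2 := abs_truncated_integral_sub_le (measurable_batemanDerivIntegrand ν y)
        (abs_batemanDerivIntegrand_le ν y) 0 b (Real.pi / 2)
      have h3 : |Real.sin b * Real.cos b * Real.cos (y * Real.tan b - ν * b)| ≤ |Real.cos b| := by
        rw [mul_right_comm, abs_mul, abs_mul]
        exact mul_le_of_le_one_left (abs_nonneg _)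
          (mul_le_one₀ (Real.abs_sin_le_one _) (abs_nonneg _) (Real.abs_cos_le_one _))
      rw [mul_comm, ← eq_div_iff hy0.ne'] at h1
      rw [h1, ← sub_div, abs_div, abs_of_pos hy0]
      refine div_le_div₀ (by positivity) ?_ hδ (le_of_lt hy)
      rw [abs_le] at h2 h3 ⊢
      constructor <;> linarith [h2.1, h2.2, h3.1, h3.2]
  · filter_upwards [eventually_mem_Ico_pi_div_two] with b hb y _
    exact hasDerivAt_truncated_cos ν y hb.1 hb.2
  · intro y hy
    refine (tendstoUniformlyOn_of_eventually_abs_sub_le (s := Ioi (x / 2))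
      (F := fun b y => ∫ θ in (0:ℝ)..b, Real.cos (y * Real.tan θ - ν * θ))
      (f := fun y => ∫ θ in (0:ℝ)..(Real.pi / 2), Real.cos (y * Real.tan θ - ν * θ))
      tendsto_abs_pi_div_two_sub (Eventually.of_forall fun b y _ => ?_)).tendsto_at hy
    simpa using abs_truncated_integral_sub_le (measurable_bateman_integrand ν y)
      (fun _ => Real.abs_cos_le_one _) 0 b (Real.pi / 2)

lemma hasDerivAt_bateman_deriv (ν : ℝ) {x : ℝ} (hx : 0 < x) :
    HasDerivAt (fun y => -(∫ θ in (0:ℝ)..(Real.pi / 2), batemanDerivIntegrand ν y θ) / y)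
      ((x - ν) / x * ∫ θ in (0:ℝ)..(Real.pi / 2), Real.cos (x * Real.tan θ - ν * θ)) x := by
  have hδ : 0 < x / 2 := by linarith
  refine hasDerivAt_of_tendstoUniformlyOn (l := 𝓝[<] (Real.pi / 2)) (s := Ioi (x / 2))
    (f := fun b y => -(∫ θ in (0:ℝ)..b, batemanDerivIntegrand ν y θ) / y)
    (f' := fun b y => (y - ν) / y * (∫ θ in (0:ℝ)..b, Real.cos (y * Real.tan θ - ν * θ))
      - Real.cos b ^ 2 * Real.sin (y * Real.tan b - ν * b) / y
      + Real.sin b * Real.cos b * Real.cos (y * Real.tan b - ν * b) / y ^ 2)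
    (g' := fun y => (y - ν) / y *
      ∫ θ in (0:ℝ)..(Real.pi / 2), Real.cos (y * Real.tan θ - ν * θ))
    isOpen_Ioi ?_ ?_ ?_ (show x / 2 < x by linarith)
  · refine tendstoUniformlyOn_of_eventually_abs_sub_le
      (c := fun b => (1 + |ν| / (x / 2)) * |Real.pi / 2 - b| + |Real.cos b| / (x / 2)
        + |Real.cos b| / (x / 2) ^ 2) ?_ ?_
    · simpa using ((tendsto_abs_pi_div_two_sub.const_mul (1 + |ν| / (x / 2))).add
        (tendsto_abs_cos_pi_div_two.div_const (x / 2))).add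
        (tendsto_abs_cos_pi_div_two.div_const ((x / 2) ^ 2))
    · filter_upwards [eventually_mem_Ico_pi_div_two] with b hb y hy
      have hy' : x / 2 < y := hy
      have hy0 : 0 < y := hδ.trans hy
      have h2 := abs_truncated_integral_sub_le (measurable_bateman_integrand ν y)
        (fun _ => Real.abs_cos_le_one _) 0 b (Real.pi / 2)
      rw [one_mul] at h2
      have h3 : |Real.sin b * Real.cos b * Real.cos (y * Real.tan b - ν * b) / y ^ 2|
          ≤ |Real.cos b| / (x / 2) ^ 2 := by
        rw [abs_div, abs_of_pos (pow_pos hy0 2), mul_right_comm, abs_mul, abs_mul]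
        refine div_le_div₀ (abs_nonneg _) ?_ (by positivity) (by gcongr)
        exact mul_le_of_le_one_left (abs_nonneg _)
          (mul_le_one₀ (Real.abs_sin_le_one _) (abs_nonneg _) (Real.abs_cos_le_one _))
      have h4 : |Real.cos b ^ 2 * Real.sin (y * Real.tan b - ν * b) / y|
          ≤ |Real.cos b| / (x / 2) := by
        rw [abs_div, abs_of_pos hy0, pow_two, mul_assoc, abs_mul, abs_mul]
        refine div_le_div₀ (abs_nonneg _) ?_ hδ hy'.le
        exact mul_le_of_le_one_right (abs_nonneg _)
          (mul_le_one₀ (Real.abs_cos_le_one _) (abs_nonneg _) (Real.abs_sin_le_one _))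
      have h5 : |(y - ν) / y| ≤ 1 + |ν| / (x / 2) := by
        rw [sub_div, div_self hy0.ne']
        refine (abs_sub _ _).trans ?_
        rw [abs_one, abs_div, abs_of_pos hy0]
        gcongr
      have h6 := mul_le_mul h5 h2 (abs_nonneg _) (by positivity)
      rw [← abs_mul, mul_sub] at h6
      rw [abs_le] at h3 h4 h6 ⊢
      constructor <;> linarith [h3.1, h3.2, h4.1, h4.2, h6.1, h6.2]
  · filter_upwards [eventually_mem_Ico_pi_div_two] with b hb y hy
    have hy0 : 0 < y := hδ.trans hy
    have hcb : Real.cos b ≠ 0 := (cos_pos_of_mem_uIcc hb.1 hb.2 right_mem_uIcc).ne'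
    have hph : HasDerivAt (fun z => z * Real.tan b - ν * b) (Real.tan b) y := by
      simpa using ((hasDerivAt_id y).mul_const (Real.tan b)).sub_const (ν * b)
    have h := (hasDerivAt_truncated_tan_mul_sin ν y hb.1 hb.2).sub
      ((hph.cos.const_mul (Real.sin b * Real.cos b)).div (hasDerivAt_id y) hy0.ne')
    have h1 := mul_truncated_tan_sq_mul_cos ν y hb.1 hb.2
    rw [mul_comm, ← eq_div_iff hy0.ne'] at h1
    rw [h1] at h
    refine (h.congr_deriv ?_).congr_of_eventuallyEq ?_
    · generalize (∫ θ in (0:ℝ)..b, Real.cos (y * Real.tan θ - ν * θ)) = I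
      simp only [id]
      generalize Real.sin (y * Real.tan b - ν * b) = S
      generalize Real.cos (y * Real.tan b - ν * b) = C
      rw [Real.tan_eq_sin_div_cos, Real.cos_sq']
      field_simp
      ring
    · filter_upwards [Ioi_mem_nhds hy0] with z hz
      have hz0 : z ≠ 0 := (show 0 < z from hz).ne'
      have h2 := mul_truncated_tan_mul_sin ν z hb.1 hb.2
      rw [mul_comm, ← eq_div_iff hz0] at h2
      simp only [Pi.sub_apply, Pi.div_apply, id, h2]
      ring
  · intro y hy
    have hy0 : 0 < y := hδ.trans hy
    refine Tendsto.div_const (Tendsto.neg ?_) y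
    refine (tendstoUniformlyOn_of_eventually_abs_sub_le (s := Ioi (x / 2))
      (F := fun b y => ∫ θ in (0:ℝ)..b, batemanDerivIntegrand ν y θ)
      (f := fun y => ∫ θ in (0:ℝ)..(Real.pi / 2), batemanDerivIntegrand ν y θ)
      (c := fun b => (1 + |ν|) * |Real.pi / 2 - b|)
      (by simpa using tendsto_abs_pi_div_two_sub.const_mul (1 + |ν|))
      (Eventually.of_forall fun b y _ => ?_)).tendsto_at hy
    exact abs_truncated_integral_sub_le (measurable_batemanDerivIntegrand ν y)
      (abs_batemanDerivIntegrand_le ν y) 0 b (Real.pi / 2)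

end Limits

theorem bateman_ode (ν x : ℝ) (hx : 0 < x) :
    DifferentiableAt ℝ (batemanK ν) x ∧
    DifferentiableAt ℝ (deriv (batemanK ν)) x ∧
    x * deriv (deriv (batemanK ν)) x = (x - ν) * batemanK ν x := by
  have h1 : ∀ y, 0 < y → HasDerivAt (batemanK ν) (2 / Real.pi *
      (-(∫ θ in (0:ℝ)..(Real.pi / 2), batemanDerivIntegrand ν y θ) / y)) y := fun y hy =>
    (hasDerivAt_bateman_integral ν hy).const_mul (2 / Real.pi)
  have h2 : HasDerivAt (deriv (batemanK ν)) (2 / Real.pi * ((x - ν) / x *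
      ∫ θ in (0:ℝ)..(Real.pi / 2), Real.cos (x * Real.tan θ - ν * θ))) x := by
    refine ((hasDerivAt_bateman_deriv ν hx).const_mul (2 / Real.pi)).congr_of_eventuallyEq ?_
    filter_upwards [Ioi_mem_nhds hx] with y hy
    exact (h1 y hy).deriv
  refine ⟨(h1 x hx).differentiableAt, h2.differentiableAt, ?_⟩
  rw [h2.deriv, batemanK]
  field_simp
end

section
/- For every integer n ≥ 1 and every x > 0, the Bateman function of order 2n satisfies k_{2n}(x) = (−1)^n e^{−x} (L_n(2x) − L_{n−1}(2x)), where L_m denotes the m-th Laguerre polynomial. -/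
/-- The m-th Laguerre polynomial `L_m(x) = Σ_{k=0}^{m} (m choose k) (−x)^k / k!`. -/
noncomputable def laguerre (m : ℕ) (x : ℝ) : ℝ :=
  ∑ k ∈ Finset.range (m + 1), (m.choose k : ℝ) * (-x) ^ k / (Nat.factorial k)

theorem norm_pow_mul_cexp_neg (k : ℕ) (s : ℂ) {t : ℝ} (ht : 0 < t) :
    ‖(t : ℂ) ^ k * Complex.exp (-(s * t))‖ = t ^ (k : ℝ) * Real.exp (-s.re * t) := by
  rw [norm_mul, norm_pow, Complex.norm_real, Real.norm_of_nonneg ht.le, Complex.norm_exp,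
    Real.rpow_natCast]
  simp

open MeasureTheory Set in
theorem integrableOn_pow_mul_cexp_neg (k : ℕ) {s : ℂ} (hs : 0 < s.re) :
    IntegrableOn (fun t : ℝ => (t : ℂ) ^ k * Complex.exp (-(s * t))) (Ioi 0) := by
  have h := integrableOn_rpow_mul_exp_neg_mul_rpow (p := 1) (s := k) (b := s.re)
    (by linarith [k.cast_nonneg (α := ℝ)]) one_pos hs
  refine Integrable.mono' h (by fun_prop) ?_
  filter_upwards [ae_restrict_mem measurableSet_Ioi] with t ht
  rw [norm_pow_mul_cexp_neg k s ht, Real.rpow_one]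

open MeasureTheory Set Filter Topology in
theorem integral_pow_mul_cexp_neg (k : ℕ) {s : ℂ} (hs : 0 < s.re) :
    ∫ t in Ioi (0 : ℝ), (t : ℂ) ^ k * Complex.exp (-(s * t)) = k.factorial / s ^ (k + 1) := by
  have hs0 : s ≠ 0 := by rintro rfl; simp at hs
  induction k with
  | zero =>
    have h := integral_exp_mul_complex_Ioi (a := -s) (by simpa using hs) 0
    simp only [neg_mul, Complex.ofReal_zero, mul_zero, Complex.exp_zero] at h
    simp only [pow_zero, one_mul, h, Nat.factorial_zero, Nat.cast_one, zero_add, pow_one]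
    rw [neg_div_neg_eq]
  | succ k ih =>
    have hderiv : ∀ t ∈ Ici (0 : ℝ),
        HasDerivAt (fun t : ℝ => (t : ℂ) ^ (k + 1) * Complex.exp (-(s * t)))
          ((k + 1) * ((t : ℂ) ^ k * Complex.exp (-(s * t)))
            - s * ((t : ℂ) ^ (k + 1) * Complex.exp (-(s * t)))) t := by
      intro t _
      have h1 : HasDerivAt (fun z : ℂ => z ^ (k + 1) * Complex.exp (-(s * z))) _ (t : ℂ) :=
        (hasDerivAt_pow (k + 1) (t : ℂ)).mul ((hasDerivAt_id (t : ℂ)).const_mul s).neg.cexp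
      refine h1.comp_ofReal.congr_deriv ?_
      simp
      ring
    have hi0 := integrableOn_pow_mul_cexp_neg k hs
    have hi1 := integrableOn_pow_mul_cexp_neg (k + 1) hs
    have hlim : Tendsto (fun t : ℝ => (t : ℂ) ^ (k + 1) * Complex.exp (-(s * t))) atTop (𝓝 0) := by
      rw [tendsto_zero_iff_norm_tendsto_zero]
      refine (tendsto_rpow_mul_exp_neg_mul_atTop_nhds_zero ((k + 1 : ℕ) : ℝ) s.re hs).congr' ?_
      filter_upwards [eventually_gt_atTop 0] with t ht
      rw [norm_pow_mul_cexp_neg _ s ht]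
    have h := integral_Ioi_of_hasDerivAt_of_tendsto' hderiv
      ((hi0.const_mul _).sub (hi1.const_mul _)) hlim
    rw [integral_sub (hi0.const_mul _) (hi1.const_mul _), integral_const_mul, integral_const_mul,
      ih] at h
    have h2 : s * ∫ t in Ioi (0 : ℝ), (t : ℂ) ^ (k + 1) * Complex.exp (-(s * t)) =
        (k + 1) * (k.factorial / s ^ (k + 1)) := by
      simp at h
      linear_combination -h
    apply mul_left_cancel₀ hs0
    rw [h2, Nat.factorial_succ]
    push_cast
    field_simp
    ring

theorem continuous_laguerre (n : ℕ) : Continuous (laguerre n) := by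
  unfold laguerre
  fun_prop

theorem laguerre_two_mul_mul_cexp (n : ℕ) (s : ℂ) (t : ℝ) :
    (laguerre n (2 * t) : ℂ) * Complex.exp (-(s * t)) =
      ∑ k ∈ Finset.range (n + 1), (n.choose k * (-2) ^ k / k.factorial : ℂ) *
        ((t : ℂ) ^ k * Complex.exp (-(s * t))) := by
  simp only [laguerre, Complex.ofReal_sum, Finset.sum_mul]
  refine Finset.sum_congr rfl fun k _ => ?_
  push_cast
  rw [show (-(2 * (t : ℂ))) = (-2) * t by ring, mul_pow]
  ring

open MeasureTheory Set in
theorem integrableOn_laguerre_mul_cexp (n : ℕ) {s : ℂ} (hs : 0 < s.re) :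
    IntegrableOn (fun t : ℝ => (laguerre n (2 * t) : ℂ) * Complex.exp (-(s * t))) (Ioi 0) := by
  simp only [laguerre_two_mul_mul_cexp]
  exact integrable_finsetSum _ fun k _ => (integrableOn_pow_mul_cexp_neg k hs).const_mul _

open MeasureTheory Set in
theorem integral_laguerre_mul_cexp (n : ℕ) {s : ℂ} (hs : 0 < s.re) :
    ∫ t in Ioi (0 : ℝ), (laguerre n (2 * t) : ℂ) * Complex.exp (-(s * t)) =
      (1 - 2 / s) ^ n / s := by
  have hs0 : s ≠ 0 := by rintro rfl; simp at hs
  simp only [laguerre_two_mul_mul_cexp]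
  rw [integral_finsetSum _ fun k _ => (integrableOn_pow_mul_cexp_neg k hs).const_mul _,
    show (1 - 2 / s) = (-2) / s + 1 by ring, add_pow, Finset.sum_div]
  refine Finset.sum_congr rfl fun k _ => ?_
  rw [integral_const_mul, integral_pow_mul_cexp_neg k hs, div_pow, one_pow]
  have : (k.factorial : ℂ) ≠ 0 := by exact_mod_cast k.factorial_ne_zero
  field_simp
  ring

/-- The right-hand side of the Bateman–Laguerre formula, extended by zero to `x ≤ 0`. -/
noncomputable def laguerreDiff (n : ℕ) : ℝ → ℂ :=
  Set.indicator (Set.Ioi 0) fun t : ℝ =>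
    (-1) ^ n * (laguerre n (2 * t) * Complex.exp (-((1 : ℂ) * t))
      - laguerre (n - 1) (2 * t) * Complex.exp (-((1 : ℂ) * t)))

open MeasureTheory Set in
theorem integrable_laguerreDiff (n : ℕ) : Integrable (laguerreDiff n) := by
  have h1 : 0 < (1 : ℂ).re := by simp
  exact (integrable_indicator_iff measurableSet_Ioi).2
    (((integrableOn_laguerre_mul_cexp n h1).sub
      (integrableOn_laguerre_mul_cexp (n - 1) h1)).const_mul _)

theorem continuousAt_laguerreDiff (n : ℕ) {x : ℝ} (hx : 0 < x) :
    ContinuousAt (laguerreDiff n) x := by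
  have hn := continuous_laguerre n
  have hm := continuous_laguerre (n - 1)
  have hc : Continuous fun t : ℝ =>
    (-1) ^ n * (laguerre n (2 * t) * Complex.exp (-((1 : ℂ) * t))
      - laguerre (n - 1) (2 * t) * Complex.exp (-((1 : ℂ) * t))) := by fun_prop
  refine hc.continuousAt.congr ?_
  filter_upwards [Ioi_mem_nhds hx] with t ht
  rw [laguerreDiff, Set.indicator_of_mem ht]

open MeasureTheory Set FourierTransform in
theorem fourier_laguerreDiff {n : ℕ} (hn : 1 ≤ n) (ξ : ℝ) :
    𝓕 (laguerreDiff n) ξ =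
      2 / (1 + (2 * Real.pi * ξ) ^ 2 : ℝ) *
        ((1 - (2 * Real.pi * ξ : ℝ) * Complex.I) / (1 + (2 * Real.pi * ξ : ℝ) * Complex.I)) ^ n := by
  set u : ℝ := 2 * Real.pi * ξ with hu
  have hs : 0 < (1 + u * Complex.I).re := by simp
  have hs0 : (1 + u * Complex.I) ≠ 0 := fun h => by simp [h] at hs
  have hs1 : ((1 + u ^ 2 : ℝ) : ℂ) ≠ 0 := by
    exact_mod_cast (by positivity : (1 + u ^ 2 : ℝ) ≠ 0)
  have hmul : ((1 + u ^ 2 : ℝ) : ℂ) = (1 + u * Complex.I) * (1 - u * Complex.I) := by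
    push_cast
    linear_combination ((u : ℂ) ^ 2) * Complex.I_sq
  have hi : ∀ v : ℝ, Complex.exp (↑(-2 * Real.pi * v * ξ) * Complex.I) • laguerreDiff n v =
      (Ioi (0 : ℝ)).indicator (fun t : ℝ => (-1) ^ n *
        (laguerre n (2 * t) * Complex.exp (-((1 + u * Complex.I) * t))
        - laguerre (n - 1) (2 * t) * Complex.exp (-((1 + u * Complex.I) * t)))) v := by
    intro v
    by_cases hv : v ∈ Ioi (0 : ℝ)
    · have he : Complex.exp (-((1 + u * Complex.I) * v)) =
          Complex.exp (↑(-2 * Real.pi * v * ξ) * Complex.I) * Complex.exp (-((1 : ℂ) * v)) := by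
        rw [← Complex.exp_add, hu]
        congr 1
        push_cast
        ring
      rw [laguerreDiff, indicator_of_mem hv, indicator_of_mem hv, he, smul_eq_mul]
      ring
    · rw [laguerreDiff, indicator_of_notMem hv, indicator_of_notMem hv, smul_zero]
  rw [Real.fourier_real_eq_integral_exp_smul]
  simp only [hi]
  rw [integral_indicator measurableSet_Ioi, integral_const_mul,
    integral_sub (integrableOn_laguerre_mul_cexp n hs) (integrableOn_laguerre_mul_cexp (n - 1) hs),
    integral_laguerre_mul_cexp n hs, integral_laguerre_mul_cexp (n - 1) hs]
  obtain ⟨m, rfl⟩ : ∃ m, n = m + 1 := ⟨n - 1, by omega⟩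
  have hd : (1 - 2 / (1 + u * Complex.I)) = -((1 - u * Complex.I) / (1 + u * Complex.I)) := by
    field_simp
    ring
  have hc0 : (1 - u * Complex.I) ≠ 0 := fun h => hs1 (by rw [hmul, h, mul_zero])
  rw [hd, hmul, Nat.add_sub_cancel, neg_pow (_ / _) (m + 1), neg_pow (_ / _) m]
  have hsq : ((-1 : ℂ) ^ m) * (-1) ^ m = 1 := by rw [← mul_pow]; simp
  generalize hw : (-1 : ℂ) ^ m = w at *
  rw [pow_succ (-1 : ℂ), hw]
  simp only [pow_succ]
  generalize hq : ((1 - u * Complex.I) / (1 + u * Complex.I)) ^ m = q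
  field_simp
  linear_combination (2 * q) * hsq

open MeasureTheory Set FourierTransform in
theorem integrable_fourier_laguerreDiff {n : ℕ} (hn : 1 ≤ n) :
    Integrable (𝓕 (laguerreDiff n)) := by
  have hpi : (2 * Real.pi) ≠ 0 := by positivity
  have h := (integrable_inv_one_add_sq.comp_mul_left' hpi).const_mul 2
  refine h.mono' ?_ (Filter.Eventually.of_forall fun ξ => ?_)
  · rw [funext (fourier_laguerreDiff hn)]
    exact Measurable.aestronglyMeasurable (by fun_prop)
  · have hn1 : ‖(1 - (2 * Real.pi * ξ : ℝ) * Complex.I) / (1 + (2 * Real.pi * ξ : ℝ) * Complex.I)‖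
        ≤ 1 := by
      rw [norm_div]
      refine div_le_one_of_le₀ (le_of_eq ?_) (norm_nonneg _)
      rw [← Complex.norm_conj, map_sub, map_mul, Complex.conj_ofReal, Complex.conj_I, map_one,
        mul_neg, sub_neg_eq_add]
    rw [fourier_laguerreDiff hn, norm_mul, norm_div, Complex.norm_real, norm_pow,
      Real.norm_of_nonneg (by positivity), Complex.norm_ofNat, div_eq_mul_inv]
    exact mul_le_of_le_one_right (by positivity) (pow_le_one₀ (norm_nonneg _) hn1)

theorem one_sub_tan_mul_I_div {θ : ℝ} (hθ : Real.cos θ ≠ 0) :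
    (1 - (Real.tan θ : ℂ) * Complex.I) / (1 + (Real.tan θ : ℂ) * Complex.I) =
      Complex.exp (-(2 * θ * Complex.I)) := by
  have hc : (Real.cos θ : ℂ) ≠ 0 := by exact_mod_cast hθ
  have hexp : Complex.exp (θ * Complex.I) = Real.cos θ + Real.sin θ * Complex.I := by
    rw [Complex.exp_mul_I, Complex.ofReal_cos, Complex.ofReal_sin]
  have hexp' : Complex.exp (-(θ * Complex.I)) = Real.cos θ - Real.sin θ * Complex.I := by
    rw [← neg_mul, Complex.exp_mul_I, Complex.cos_neg, Complex.sin_neg, Complex.ofReal_cos,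
      Complex.ofReal_sin]
    ring
  have hne : (Real.cos θ + Real.sin θ * Complex.I : ℂ) ≠ 0 := hexp ▸ Complex.exp_ne_zero _
  rw [show -(2 * θ * Complex.I) = -(θ * Complex.I) - θ * Complex.I by ring, Complex.exp_sub, hexp,
    hexp', Real.tan_eq_sin_div_cos, Complex.ofReal_div]
  rw [← mul_div_mul_left _ _ hc]
  congr 1 <;> field_simp

open MeasureTheory Set in
theorem integral_eq_integral_tan (f : ℝ → ℂ) :
    ∫ ξ, f ξ = ∫ θ in Ioo (-(Real.pi / 2)) (Real.pi / 2),
      (1 / (2 * Real.pi) * (1 / Real.cos θ ^ 2) : ℝ) • f (1 / (2 * Real.pi) * Real.tan θ) := by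
  have himg : (fun θ => 1 / (2 * Real.pi) * Real.tan θ) '' Ioo (-(Real.pi / 2)) (Real.pi / 2)
      = univ := by
    rw [← image_image (fun y => 1 / (2 * Real.pi) * y) Real.tan, Real.image_tan_Ioo, image_univ,
      range_eq_univ]
    exact mul_left_surjective₀ (by positivity)
  have hinj : InjOn (fun θ => 1 / (2 * Real.pi) * Real.tan θ)
      (Ioo (-(Real.pi / 2)) (Real.pi / 2)) := by
    intro a ha b hb hab
    exact Real.injOn_tan ha hb (mul_left_cancel₀ (by positivity) hab)
  have h := integral_image_eq_integral_abs_deriv_smul measurableSet_Ioo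
    (fun θ hθ => ((Real.hasDerivAt_tan (Real.cos_pos_of_mem_Ioo hθ).ne').const_mul
      (1 / (2 * Real.pi))).hasDerivWithinAt) hinj f
  rw [himg, setIntegral_univ] at h
  rw [h]
  refine setIntegral_congr_fun measurableSet_Ioo fun θ _ => ?_
  rw [abs_of_nonneg (by positivity)]

open MeasureTheory Set in
theorem laguerreDiff_eq_integral {n : ℕ} (hn : 1 ≤ n) {x : ℝ} (hx : 0 < x) :
    laguerreDiff n x = ∫ θ in Ioo (-(Real.pi / 2)) (Real.pi / 2),
      (1 / Real.pi : ℂ) * Complex.exp ((x * Real.tan θ - 2 * n * θ : ℝ) * Complex.I) := by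
  rw [← (integrable_laguerreDiff n).fourierInv_fourier_eq (integrable_fourier_laguerreDiff hn)
    (continuousAt_laguerreDiff n hx), Real.fourierInv_eq', integral_eq_integral_tan]
  refine setIntegral_congr_fun measurableSet_Ioo fun θ hθ => ?_
  have hcos := (Real.cos_pos_of_mem_Ioo hθ).ne'
  have hpi := Real.pi_ne_zero
  have hcosC : (Real.cos θ : ℂ) ≠ 0 := by exact_mod_cast hcos
  have hpiC : (Real.pi : ℂ) ≠ 0 := by exact_mod_cast hpi
  have ht : 2 * Real.pi * (1 / (2 * Real.pi) * Real.tan θ) = Real.tan θ := by field_simp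
  have hsec : (1 + Real.tan θ ^ 2) = 1 / Real.cos θ ^ 2 := by
    rw [← Real.inv_one_add_tan_sq hcos]
    simp
  have hexp : Complex.exp ((x * Real.tan θ - 2 * n * θ : ℝ) * Complex.I) =
      Complex.exp ((x * Real.tan θ : ℝ) * Complex.I) * Complex.exp (-(2 * θ * Complex.I)) ^ n := by
    rw [← Complex.exp_nat_mul, ← Complex.exp_add]
    congr 1
    push_cast
    ring
  have hph : 2 * Real.pi * inner ℝ (1 / (2 * Real.pi) * Real.tan θ) x = x * Real.tan θ := by
    rw [real_inner_comm]
    simp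
    field_simp
  rw [fourier_laguerreDiff hn, ht, hsec, one_sub_tan_mul_I_div hcos, hph, hexp, smul_eq_mul,
    Complex.real_smul]
  push_cast at hcosC ⊢
  field_simp

theorem laguerreDiff_apply (n : ℕ) {x : ℝ} (hx : 0 < x) :
    laguerreDiff n x = ((-1 : ℝ) ^ n * Real.exp (-x) *
      (laguerre n (2 * x) - laguerre (n - 1) (2 * x)) : ℝ) := by
  rw [laguerreDiff, Set.indicator_of_mem (Set.mem_Ioi.2 hx)]
  push_cast
  rw [one_mul]
  ring

open MeasureTheory Set in
theorem integrableOn_cexp_tan_sub (x ν : ℝ) : IntegrableOn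
    (fun θ : ℝ => Complex.exp ((x * Real.tan θ - ν * θ : ℝ) * Complex.I))
      (Ioo (-(Real.pi / 2)) (Real.pi / 2)) := by
  have htan : Measurable Real.tan := by
    rw [funext Real.tan_eq_sin_div_cos]
    fun_prop
  refine Measure.integrableOn_of_bounded (M := 1) measure_Ioo_lt_top.ne
    (Measurable.aestronglyMeasurable (by fun_prop)) ?_
  exact Filter.Eventually.of_forall fun θ => (Complex.norm_exp_ofReal_mul_I _).le

open MeasureTheory Set in
theorem batemanK_eq_integral_Ioo (ν x : ℝ) :
    batemanK ν x = (1 / Real.pi) * ∫ θ in Ioo (-(Real.pi / 2)) (Real.pi / 2),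
      Real.cos (x * Real.tan θ - ν * θ) := by
  have hle : -(Real.pi / 2) ≤ Real.pi / 2 := by linarith [Real.pi_pos]
  have hre : IntegrableOn (fun θ => Real.cos (x * Real.tan θ - ν * θ))
      (Ioo (-(Real.pi / 2)) (Real.pi / 2)) := by
    have h := (integrableOn_cexp_tan_sub x ν).re
    simp only [RCLike.re_eq_complex_re, Complex.exp_ofReal_mul_I_re] at h
    exact h
  have hint : IntervalIntegrable (fun θ => Real.cos (x * Real.tan θ - ν * θ)) volume
      (-(Real.pi / 2)) (Real.pi / 2) :=
    (intervalIntegrable_iff_integrableOn_Ioo_of_le hle).2 hre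
  have hmem : (0 : ℝ) ∈ uIcc (-(Real.pi / 2)) (Real.pi / 2) := by
    rw [uIcc_of_le hle]
    constructor <;> linarith [Real.pi_pos]
  have hleft : ∫ θ in (-(Real.pi / 2))..0, Real.cos (x * Real.tan θ - ν * θ) =
      ∫ θ in (0 : ℝ)..(Real.pi / 2), Real.cos (x * Real.tan θ - ν * θ) := by
    rw [← neg_zero, ← intervalIntegral.integral_comp_neg, neg_zero]
    refine intervalIntegral.integral_congr fun θ _ => ?_
    simp only [Real.tan_neg]
    rw [← Real.cos_neg]
    congr 1
    ring
  rw [batemanK, ← integral_Ioc_eq_integral_Ioo, ← intervalIntegral.integral_of_le hle,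
    ← intervalIntegral.integral_add_adjacent_intervals
      (hint.mono_set (uIcc_subset_uIcc_left hmem)) (hint.mono_set (uIcc_subset_uIcc_right hmem)),
    hleft]
  ring

theorem bateman_laguerre (n : ℕ) (hn : 1 ≤ n) (x : ℝ) (hx : 0 < x) :
    batemanK (2 * n) x =
      (-1 : ℝ) ^ n * Real.exp (-x) * (laguerre n (2 * x) - laguerre (n - 1) (2 * x)) := by
  have h := laguerreDiff_eq_integral hn hx
  rw [laguerreDiff_apply n hx, MeasureTheory.integral_const_mul] at h
  have hre := congrArg Complex.re h
  rw [Complex.ofReal_re, ← Complex.ofReal_one, ← Complex.ofReal_div, Complex.re_ofReal_mul,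
    ← RCLike.re_eq_complex_re, ← integral_re (integrableOn_cexp_tan_sub x (2 * n))] at hre
  simp only [RCLike.re_eq_complex_re, Complex.exp_ofReal_mul_I_re] at hre
  rw [hre, batemanK_eq_integral_Ioo]
end

section
/- For every integer n ≥ 1 and every x > 0, the Bateman functions of even integer order satisfy the three-term recurrence relation (2x − 2n)·k_{2n}(x) = (n − 1)·k_{2n−2}(x) + (n + 1)·k_{2n+2}(x). -/
theorem intervalIntegrable_cos_tan_sub (ν x a b : ℝ) :
    IntervalIntegrable (fun θ : ℝ => Real.cos (x * Real.tan θ - ν * θ))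
      MeasureTheory.volume a b := by
  refine (intervalIntegrable_const (c := (1 : ℝ))).mono_fun ?_ ?_
  · have h : Measurable Real.tan := by
      have : Real.tan = fun θ => Real.sin θ / Real.cos θ := funext Real.tan_eq_sin_div_cos
      rw [this]
      fun_prop
    exact Measurable.aestronglyMeasurable (by fun_prop)
  · refine Filter.Eventually.of_forall fun θ => ?_
    simpa using Real.abs_cos_le_one _

theorem hasDerivAt_cos_sq_mul_sin_tan_sub (ν x θ : ℝ) (hθ : Real.cos θ ≠ 0) :
    HasDerivAt (fun t : ℝ => Real.cos t ^ 2 * Real.sin (x * Real.tan t - ν * t))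
      ((x - ν / 2) * Real.cos (x * Real.tan θ - ν * θ)
        - (ν / 2 - 1) / 2 * Real.cos (x * Real.tan θ - (ν - 2) * θ)
        - (ν / 2 + 1) / 2 * Real.cos (x * Real.tan θ - (ν + 2) * θ)) θ := by
  have h := ((Real.hasDerivAt_cos θ).pow 2).mul
    ((((Real.hasDerivAt_tan hθ).const_mul x).sub ((hasDerivAt_id θ).const_mul ν)).sin)
  refine h.congr_deriv ?_
  have e₁ : x * Real.tan θ - (ν - 2) * θ = (x * Real.tan θ - ν * θ) + 2 * θ := by ring
  have e₂ : x * Real.tan θ - (ν + 2) * θ = (x * Real.tan θ - ν * θ) - 2 * θ := by ring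
  simp only [Pi.sub_apply, Pi.pow_apply, id, e₁, e₂]
  generalize x * Real.tan θ - ν * θ = φ
  rw [Real.cos_add, Real.cos_sub, Real.cos_two_mul, Real.sin_two_mul]
  field_simp
  ring

theorem continuous_cos_sq_mul_sin_tan_sub (ν x : ℝ) :
    Continuous (fun t : ℝ => Real.cos t ^ 2 * Real.sin (x * Real.tan t - ν * t)) := by
  refine continuous_iff_continuousAt.2 fun θ => ?_
  by_cases hθ : Real.cos θ = 0
  · have h : Filter.Tendsto (fun t : ℝ => Real.cos t ^ 2) (nhds θ) (nhds 0) := by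
      have : Continuous fun t : ℝ => Real.cos t ^ 2 := by fun_prop
      simpa [hθ] using this.tendsto θ
    rw [ContinuousAt]
    simp only [hθ, ne_eq, OfNat.ofNat_ne_zero, not_false_eq_true, zero_pow, zero_mul]
    refine squeeze_zero_norm (fun t => ?_) h
    rw [norm_mul, Real.norm_eq_abs, Real.norm_eq_abs, abs_of_nonneg (sq_nonneg (Real.cos t))]
    exact mul_le_of_le_one_right (sq_nonneg _) (Real.abs_sin_le_one _)
  · exact (hasDerivAt_cos_sq_mul_sin_tan_sub ν x θ hθ).continuousAt

/-- The three-term recurrence holds for arbitrary real order and argument. -/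
theorem batemanK_recurrence_real (ν x : ℝ) :
    (x - ν / 2) * batemanK ν x
      - (ν / 2 - 1) / 2 * batemanK (ν - 2) x - (ν / 2 + 1) / 2 * batemanK (ν + 2) x = 0 := by
  have i₀ := (intervalIntegrable_cos_tan_sub ν x 0 (Real.pi / 2)).const_mul (x - ν / 2)
  have i₁ := (intervalIntegrable_cos_tan_sub (ν - 2) x 0 (Real.pi / 2)).const_mul
    ((ν / 2 - 1) / 2)
  have i₂ := (intervalIntegrable_cos_tan_sub (ν + 2) x 0 (Real.pi / 2)).const_mul
    ((ν / 2 + 1) / 2)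
  have h := intervalIntegral.integral_eq_sub_of_hasDerivAt_of_le
    (by positivity : (0 : ℝ) ≤ Real.pi / 2)
    (continuous_cos_sq_mul_sin_tan_sub ν x).continuousOn
    (fun θ hθ => hasDerivAt_cos_sq_mul_sin_tan_sub ν x θ
      (Real.cos_pos_of_mem_Ioo ⟨by linarith [hθ.1, Real.pi_pos], hθ.2⟩).ne')
    ((i₀.sub i₁).sub i₂)
  rw [intervalIntegral.integral_sub (i₀.sub i₁) i₂, intervalIntegral.integral_sub i₀ i₁,
    intervalIntegral.integral_const_mul, intervalIntegral.integral_const_mul,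
    intervalIntegral.integral_const_mul] at h
  simp only [Real.cos_pi_div_two, Real.tan_zero, mul_zero, sub_zero, Real.sin_zero, ne_eq,
    OfNat.ofNat_ne_zero, not_false_eq_true, zero_pow, zero_mul] at h
  unfold batemanK
  linear_combination (2 / Real.pi) * h

theorem bateman_recurrence (n : ℕ) (hn : 1 ≤ n) (x : ℝ) (hx : 0 < x) :
    (2 * x - 2 * n) * batemanK (2 * n) x =
      ((n : ℝ) - 1) * batemanK (2 * n - 2) x + ((n : ℝ) + 1) * batemanK (2 * n + 2) x := by
  linear_combination 2 * batemanK_recurrence_real (2 * n) x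
end

section
/- For every real ν and every x > 0, the Bateman function k_ν is differentiable at x and satisfies the differential-difference relation 4x·k_ν'(x) = (ν − 2)·k_{ν−2}(x) − (ν + 2)·k_{ν+2}(x). -/
open Filter Topology MeasureTheory Set

/-- The integral `∫₀ᵀ cos(x·tan θ − ν·θ) dθ`, a truncation of the integral defining `k_ν`. -/
noncomputable def truncatedBateman (ν T x : ℝ) : ℝ :=
  ∫ θ in (0:ℝ)..T, Real.cos (x * Real.tan θ - ν * θ)

theorem measurable_bateman_phase (ν x : ℝ) :
    Measurable fun θ : ℝ => x * Real.tan θ - ν * θ := by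
  have htan : Measurable Real.tan := by
    have h : Real.tan = fun θ => Real.sin θ / Real.cos θ := funext Real.tan_eq_sin_div_cos
    rw [h]
    exact Real.measurable_sin.div Real.measurable_cos
  exact (htan.const_mul x).sub (measurable_id.const_mul ν)

theorem intervalIntegrable_bateman (ν x a b : ℝ) :
    IntervalIntegrable (fun θ : ℝ => Real.cos (x * Real.tan θ - ν * θ)) volume a b := by
  refine (intervalIntegrable_const (c := (1:ℝ))).mono_fun
    (Real.measurable_cos.comp (measurable_bateman_phase ν x)).aestronglyMeasurable ?_
  refine Eventually.of_forall fun θ => ?_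
  simpa using Real.abs_cos_le_one (x * Real.tan θ - ν * θ)

theorem abs_truncatedBateman_sub_le (ν x S T : ℝ) :
    |truncatedBateman ν S x - truncatedBateman ν T x| ≤ |S - T| := by
  have h : truncatedBateman ν S x - truncatedBateman ν T x
      = ∫ θ in T..S, Real.cos (x * Real.tan θ - ν * θ) :=
    intervalIntegral.integral_interval_sub_left
      (intervalIntegrable_bateman ν x 0 S) (intervalIntegrable_bateman ν x 0 T)
  rw [h, ← one_mul |S - T|]
  exact intervalIntegral.norm_integral_le_of_norm_le_const
    (f := fun θ => Real.cos (x * Real.tan θ - ν * θ)) fun _ _ => Real.abs_cos_le_one _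

theorem cos_ne_zero_of_mem_uIcc {T θ : ℝ} (hT₀ : 0 < T) (hT : T < Real.pi / 2)
    (hθ : θ ∈ uIcc 0 T) : Real.cos θ ≠ 0 := by
  rw [uIcc_of_le hT₀.le] at hθ
  exact (Real.cos_pos_of_mem_Ioo ⟨by linarith [hθ.1, Real.pi_pos], by linarith [hθ.2]⟩).ne'

theorem continuousOn_tan_uIcc_s6 {T : ℝ} (hT₀ : 0 < T) (hT : T < Real.pi / 2) :
    ContinuousOn Real.tan (uIcc 0 T) :=
  Real.continuousOn_tan.mono fun _ hθ => cos_ne_zero_of_mem_uIcc hT₀ hT hθ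

theorem intervalIntegrable_sin_mul_tan (ν x : ℝ) {T : ℝ} (hT₀ : 0 < T) (hT : T < Real.pi / 2) :
    IntervalIntegrable (fun θ => -(Real.sin (x * Real.tan θ - ν * θ) * Real.tan θ))
      volume 0 T := by
  have htan := continuousOn_tan_uIcc_s6 hT₀ hT
  refine ContinuousOn.intervalIntegrable ?_
  fun_prop

theorem hasDerivAt_truncatedBateman (ν x : ℝ) {T : ℝ} (hT₀ : 0 < T) (hT : T < Real.pi / 2) :
    HasDerivAt (truncatedBateman ν T)
      (∫ θ in (0:ℝ)..T, -(Real.sin (x * Real.tan θ - ν * θ) * Real.tan θ)) x := by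
  refine (intervalIntegral.hasDerivAt_integral_of_dominated_loc_of_deriv_le
    (F := fun x θ => Real.cos (x * Real.tan θ - ν * θ))
    (F' := fun x θ => -(Real.sin (x * Real.tan θ - ν * θ) * Real.tan θ))
    (bound := fun θ => |Real.tan θ|) univ_mem ?_ (intervalIntegrable_bateman ν x 0 T)
    ?_ ?_ ?_ ?_).2
  · exact Eventually.of_forall fun y =>
      (Real.measurable_cos.comp (measurable_bateman_phase ν y)).aestronglyMeasurable
  · exact (intervalIntegrable_iff.mp (intervalIntegrable_sin_mul_tan ν x hT₀ hT)).1
  · refine Eventually.of_forall fun θ _ y _ => ?_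
    rw [norm_neg, norm_mul, Real.norm_eq_abs, Real.norm_eq_abs]
    exact mul_le_of_le_one_left (abs_nonneg _) (Real.abs_sin_le_one _)
  · exact (continuousOn_tan_uIcc_s6 hT₀ hT).abs.intervalIntegrable
  · refine Eventually.of_forall fun θ _ y _ => ?_
    have h := ((hasDerivAt_id y).mul_const (Real.tan θ)).sub_const (ν * θ) |>.cos
    simpa using h

theorem truncatedBateman_recurrence (ν x : ℝ) {T : ℝ} (hT₀ : 0 < T) (hT : T < Real.pi / 2) :
    4 * x * (∫ θ in (0:ℝ)..T, -(Real.sin (x * Real.tan θ - ν * θ) * Real.tan θ))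
      = (ν - 2) * truncatedBateman (ν - 2) T x - (ν + 2) * truncatedBateman (ν + 2) T x
        + 2 * Real.cos (x * Real.tan T - ν * T) * Real.sin (2 * T) := by
  have hsin := (intervalIntegrable_sin_mul_tan ν x hT₀ hT).const_mul (4 * x)
  have hcos₁ := (intervalIntegrable_bateman (ν - 2) x 0 T).const_mul (ν - 2)
  have hcos₂ := (intervalIntegrable_bateman (ν + 2) x 0 T).const_mul (ν + 2)
  have key := intervalIntegral.integral_eq_sub_of_hasDerivAt
    (f := fun θ => 2 * Real.cos (x * Real.tan θ - ν * θ) * Real.sin (2 * θ))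
    (fun θ hθ => ?_) (hsin.sub (hcos₁.sub hcos₂))
  · rw [intervalIntegral.integral_sub hsin (hcos₁.sub hcos₂),
      intervalIntegral.integral_sub hcos₁ hcos₂, intervalIntegral.integral_const_mul,
      intervalIntegral.integral_const_mul, intervalIntegral.integral_const_mul] at key
    simp only [mul_zero, Real.sin_zero, sub_zero] at key
    unfold truncatedBateman
    linarith
  · have hc := cos_ne_zero_of_mem_uIcc hT₀ hT hθ
    have hphase : HasDerivAt (fun θ => x * Real.tan θ - ν * θ)
        (x * (1 / Real.cos θ ^ 2) - ν * 1) θ :=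
      ((Real.hasDerivAt_tan hc).const_mul x).sub ((hasDerivAt_id θ).const_mul ν)
    have hdouble : HasDerivAt (fun θ : ℝ => 2 * θ) (2 * 1) θ := (hasDerivAt_id θ).const_mul 2
    refine ((hphase.cos.const_mul 2).mul hdouble.sin).congr_deriv ?_
    have e₁ : x * Real.tan θ - (ν - 2) * θ = (x * Real.tan θ - ν * θ) + 2 * θ := by ring
    have e₂ : x * Real.tan θ - (ν + 2) * θ = (x * Real.tan θ - ν * θ) - 2 * θ := by ring
    rw [e₁, e₂]
    generalize x * Real.tan θ - ν * θ = φ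
    rw [Real.cos_add, Real.cos_sub, Real.sin_two_mul, Real.tan_eq_sin_div_cos]
    field_simp
    ring

theorem hasDerivAt_truncatedBateman_pi_div_two (ν x : ℝ) (hx : 0 < x) :
    HasDerivAt (truncatedBateman ν (Real.pi / 2))
      (((ν - 2) * truncatedBateman (ν - 2) (Real.pi / 2) x
        - (ν + 2) * truncatedBateman (ν + 2) (Real.pi / 2) x) / (4 * x)) x := by
  have hT : ∀ᶠ T in 𝓝[<] (Real.pi / 2), T ∈ Ioo 0 (Real.pi / 2) :=
    Ioo_mem_nhdsLT Real.pi_div_two_pos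
  refine hasDerivAt_of_tendstoUniformlyOn (l := 𝓝[<] (Real.pi / 2)) (s := Ioi (x / 2))
    (f := fun T => truncatedBateman ν T)
    (f' := fun T y => ∫ θ in (0:ℝ)..T, -(Real.sin (y * Real.tan θ - ν * θ) * Real.tan θ))
    (g' := fun y => ((ν - 2) * truncatedBateman (ν - 2) (Real.pi / 2) y
        - (ν + 2) * truncatedBateman (ν + 2) (Real.pi / 2) y) / (4 * y))
    isOpen_Ioi ?_ ?_ ?_ (half_lt_self hx)
  · rw [Metric.tendstoUniformlyOn_iff]
    intro ε hε
    have hlim : Tendsto (fun T => ((|ν - 2| + |ν + 2|) * |Real.pi / 2 - T|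
        + 2 * |Real.sin (2 * T)|) / (2 * x)) (𝓝[<] (Real.pi / 2)) (𝓝 0) := by
      have hcont : Continuous (fun T => ((|ν - 2| + |ν + 2|) * |Real.pi / 2 - T|
        + 2 * |Real.sin (2 * T)|) / (2 * x)) := by fun_prop
      have h := hcont.tendsto (Real.pi / 2)
      have h₂ : 2 * (Real.pi / 2) = Real.pi := by ring
      simp only [h₂, sub_self, abs_zero, mul_zero, Real.sin_pi, add_zero, zero_div] at h
      exact h.mono_left nhdsWithin_le_nhds
    filter_upwards [hT, hlim.eventually_lt_const hε] with T hT hTε y hy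
    refine lt_of_le_of_lt ?_ hTε
    have hy' : x / 2 < y := hy
    have hy₀ : 0 < 4 * y := by linarith
    have hrec := truncatedBateman_recurrence ν y hT.1 hT.2
    rw [Real.dist_eq, ← mul_div_cancel_left₀ (∫ θ in (0:ℝ)..T, _) hy₀.ne', hrec, ← sub_div,
      abs_div, abs_of_pos hy₀]
    refine div_le_div₀ (by positivity) ?_ (by linarith) (by linarith)
    have h₁ := abs_truncatedBateman_sub_le (ν - 2) y (Real.pi / 2) T
    have h₂ := abs_truncatedBateman_sub_le (ν + 2) y (Real.pi / 2) T
    calc _ = |(ν - 2) * (truncatedBateman (ν - 2) (Real.pi / 2) y - truncatedBateman (ν - 2) T y)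
          - (ν + 2) * (truncatedBateman (ν + 2) (Real.pi / 2) y - truncatedBateman (ν + 2) T y)
          - 2 * Real.cos (y * Real.tan T - ν * T) * Real.sin (2 * T)| := by congr 1; ring
      _ ≤ |ν - 2| * |Real.pi / 2 - T| + |ν + 2| * |Real.pi / 2 - T|
          + 2 * 1 * |Real.sin (2 * T)| := by
        refine (abs_sub _ _).trans (add_le_add ((abs_sub _ _).trans (add_le_add ?_ ?_)) ?_)
        · rw [abs_mul]; gcongr
        · rw [abs_mul]; gcongr
        · rw [abs_mul, abs_mul, abs_two]; gcongr; exact Real.abs_cos_le_one _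
      _ = _ := by ring
  · filter_upwards [hT] with T hT y _
    exact hasDerivAt_truncatedBateman ν y hT.1 hT.2
  · intro y _
    rw [tendsto_iff_dist_tendsto_zero]
    have hlim : Tendsto (fun T => |T - Real.pi / 2|) (𝓝[<] (Real.pi / 2)) (𝓝 0) := by
      have hcont : Continuous (fun T => |T - Real.pi / 2|) := by fun_prop
      have h := hcont.tendsto (Real.pi / 2)
      rw [sub_self, abs_zero] at h
      exact h.mono_left nhdsWithin_le_nhds
    exact squeeze_zero (fun _ => dist_nonneg)
      (fun T => abs_truncatedBateman_sub_le ν y T (Real.pi / 2)) hlim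

theorem bateman_deriv_recurrence (ν x : ℝ) (hx : 0 < x) :
    DifferentiableAt ℝ (batemanK ν) x ∧
    4 * x * deriv (batemanK ν) x = (ν - 2) * batemanK (ν - 2) x - (ν + 2) * batemanK (ν + 2) x := by
  have hK : ∀ μ, batemanK μ = fun y => 2 / Real.pi * truncatedBateman μ (Real.pi / 2) y :=
    fun _ => rfl
  have h : HasDerivAt (batemanK ν) _ x :=
    (hasDerivAt_truncatedBateman_pi_div_two ν x hx).const_mul (2 / Real.pi)
  refine ⟨h.differentiableAt, ?_⟩
  rw [h.deriv, hK (ν - 2), hK (ν + 2)]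
  field_simp
end

section
/- For every x > 0 and every real t with |t| < 1, the series Σ_{n=0}^∞ (−1)^n t^n k_{2n}(x) converges and its sum equals e^{−x(1+t)/(1−t)}; equivalently, the functions F_n(x) = (−1)^n k_{2n}(x) are the coefficients of the generating function e^{−x(1+t)/(1−t)} = Σ_{n=0}^∞ t^n F_n(x). -/
/-- The Cayley transform `z ↦ (z - 1) / (z + 1)` maps the closed unit disc to the closed left
half-plane. -/
lemma cayley_re_nonpos {z : ℂ} (hz : ‖z‖ ≤ 1) : ((z - 1) / (z + 1)).re ≤ 0 := by
  have h : z.re * z.re + z.im * z.im ≤ 1 := by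
    rw [← Complex.normSq_apply, Complex.normSq_eq_norm_sq]
    exact pow_le_one₀ (norm_nonneg z) hz
  rw [Complex.div_re, ← add_div]
  refine div_nonpos_of_nonpos_of_nonneg ?_ (Complex.normSq_nonneg _)
  simp only [Complex.sub_re, Complex.sub_im, Complex.add_re, Complex.add_im, Complex.one_re,
    Complex.one_im]
  nlinarith

lemma norm_exp_cayley_le_one {x : ℝ} (hx : 0 ≤ x) {z : ℂ} (hz : ‖z‖ ≤ 1) :
    ‖Complex.exp (x * ((z - 1) / (z + 1)))‖ ≤ 1 := by
  rw [Complex.norm_exp, Complex.re_ofReal_mul, Real.exp_le_one_iff]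
  exact mul_nonpos_of_nonneg_of_nonpos hx (cayley_re_nonpos hz)

lemma add_ofReal_ne_zero_of_abs_lt_norm {t : ℝ} {z : ℂ} (h : |t| < ‖z‖) : z + t ≠ 0 := by
  intro h0
  rw [eq_neg_of_add_eq_zero_left h0, norm_neg, Complex.norm_real, Real.norm_eq_abs] at h
  exact lt_irrefl _ h

lemma integral_exp_cayley_circleMap_of_lt_one (x : ℝ) {t r : ℝ} (htr : |t| < r) (hr : r < 1) :
    ∫ φ in (0 : ℝ)..(2 * Real.pi),
      Complex.exp (x * ((circleMap 0 r φ - 1) / (circleMap 0 r φ + 1))) *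
        (circleMap 0 r φ / (circleMap 0 r φ + t)) =
      2 * Real.pi * Complex.exp (x * ((-t - 1) / (-t + 1))) := by
  have hr0 : 0 < r := (abs_nonneg t).trans_lt htr
  have hd : DiffContOnCl ℂ (fun z : ℂ => Complex.exp (x * ((z - 1) / (z + 1))))
      (Metric.ball 0 r) := by
    apply DifferentiableOn.diffContOnCl
    rw [closure_ball _ hr0.ne']
    intro z hz
    have hz1 : z + 1 ≠ 0 := by
      intro h
      rw [eq_neg_of_add_eq_zero_left h] at hz
      simp at hz
      linarith
    apply DifferentiableAt.differentiableWithinAt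
    fun_prop (disch := assumption)
  have hw : (-t : ℂ) ∈ Metric.ball (0 : ℂ) r := by
    simpa using htr
  have key := hd.circleIntegral_sub_inv_smul hw
  rw [circleIntegral] at key
  have hI : (Complex.I : ℂ) ≠ 0 := Complex.I_ne_zero
  apply mul_left_cancel₀ hI
  rw [← intervalIntegral.integral_const_mul]
  refine Eq.trans ?_ (key.trans ?_)
  · apply intervalIntegral.integral_congr
    intro φ _
    simp only [deriv_circleMap, smul_eq_mul, sub_neg_eq_add, div_eq_mul_inv]
    ring
  · simp only [smul_eq_mul]
    ring

lemma integral_exp_cayley_circleMap {x t : ℝ} (hx : 0 ≤ x) (ht : |t| < 1) :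
    ∫ φ in (0 : ℝ)..(2 * Real.pi),
      Complex.exp (x * ((circleMap 0 1 φ - 1) / (circleMap 0 1 φ + 1))) *
        (circleMap 0 1 φ / (circleMap 0 1 φ + t)) =
      2 * Real.pi * Complex.exp (x * ((-t - 1) / (-t + 1))) := by
  obtain ⟨ρ, htρ, hρ⟩ := exists_between ht
  have hmem : ∀ᶠ r : ℝ in nhdsWithin 1 (Set.Iio 1), ρ < r ∧ r < 1 :=
    Ioo_mem_nhdsLT hρ
  have hlim := intervalIntegral.tendsto_integral_filter_of_dominated_convergence
    (μ := MeasureTheory.volume) (a := 0) (b := 2 * Real.pi)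
    (l := nhdsWithin (1 : ℝ) (Set.Iio 1))
    (F := fun (r : ℝ) (φ : ℝ) =>
      Complex.exp (x * ((circleMap 0 r φ - 1) / (circleMap 0 r φ + 1))) *
        (circleMap 0 r φ / (circleMap 0 r φ + t)))
    (f := fun φ : ℝ =>
      Complex.exp (x * ((circleMap 0 1 φ - 1) / (circleMap 0 1 φ + 1))) *
        (circleMap 0 1 φ / (circleMap 0 1 φ + t)))
    (fun _ => 1 / (ρ - |t|)) ?_ ?_ ?_ ?_
  · refine tendsto_nhds_unique hlim (tendsto_const_nhds.congr' ?_)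
    filter_upwards [hmem] with r hr
    exact (integral_exp_cayley_circleMap_of_lt_one x (htρ.trans hr.1) hr.2).symm
  · refine Filter.Eventually.of_forall fun r => Measurable.aestronglyMeasurable ?_
    have : Measurable (circleMap 0 r) := (continuous_circleMap 0 r).measurable
    fun_prop
  · filter_upwards [hmem] with r hr
    refine Filter.Eventually.of_forall fun φ _ => ?_
    have hr0 : 0 < r := ((abs_nonneg t).trans_lt htρ).trans hr.1
    have hn : ‖circleMap 0 r φ‖ = r := by simp [abs_of_pos hr0]
    have hlow : ρ - |t| ≤ ‖circleMap 0 r φ + t‖ := by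
      have := norm_sub_le_norm_add (circleMap 0 r φ) (t : ℂ)
      rw [hn, Complex.norm_real, Real.norm_eq_abs] at this
      linarith [hr.1]
    rw [norm_mul, norm_div, hn]
    calc _ ≤ 1 * (1 / (ρ - |t|)) := by
          refine mul_le_mul (norm_exp_cayley_le_one hx (hn.trans_le hr.2.le)) ?_ (by positivity)
            zero_le_one
          exact div_le_div₀ zero_le_one hr.2.le (sub_pos.2 htρ) hlow
      _ = _ := one_mul _
  · exact intervalIntegrable_const
  · have hc := ((Set.countable_singleton (-1 : ℂ)).preimage_circleMap 0 one_ne_zero).ae_notMem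
      MeasureTheory.volume
    filter_upwards [hc] with φ hφ _
    have h1 : circleMap 0 1 φ + 1 ≠ 0 := fun h => hφ (eq_neg_of_add_eq_zero_left h)
    have h2 : circleMap 0 1 φ + t ≠ 0 :=
      add_ofReal_ne_zero_of_abs_lt_norm (by simpa using ht)
    refine Filter.Tendsto.mono_left ?_ nhdsWithin_le_nhds
    have hcm : ContinuousAt (fun r : ℝ => circleMap 0 r φ) 1 := by
      unfold circleMap
      fun_prop
    have : ContinuousAt (fun r : ℝ =>
        Complex.exp (x * ((circleMap 0 r φ - 1) / (circleMap 0 r φ + 1))) *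
        (circleMap 0 r φ / (circleMap 0 r φ + t))) 1 := by
      fun_prop (disch := assumption)
    exact this

lemma I_mul_tan_eq_cayley (θ : ℝ) :
    Complex.I * (Real.tan θ : ℂ) =
      (circleMap 0 1 (2 * θ) - 1) / (circleMap 0 1 (2 * θ) + 1) := by
  have hz : circleMap 0 1 (2 * θ) =
      Complex.exp (θ * Complex.I) * Complex.exp (θ * Complex.I) := by
    rw [← Complex.exp_add, circleMap]
    push_cast
    rw [zero_add, one_mul]
    ring_nf
  have hs := Complex.sin_sq_add_cos_sq (θ : ℂ)
  have hsub : circleMap 0 1 (2 * θ) - 1 =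
      2 * Complex.exp (θ * Complex.I) * (Complex.I * Complex.sin θ) := by
    rw [hz, Complex.exp_mul_I]
    linear_combination hs - Complex.sin θ ^ 2 * Complex.I_sq
  have hadd : circleMap 0 1 (2 * θ) + 1 =
      2 * Complex.exp (θ * Complex.I) * Complex.cos θ := by
    rw [hz, Complex.exp_mul_I]
    linear_combination -hs + Complex.sin θ ^ 2 * Complex.I_sq
  rw [hsub, hadd, mul_div_mul_left _ _ (mul_ne_zero two_ne_zero (Complex.exp_ne_zero _)),
    Complex.ofReal_tan, Complex.tan_eq_sin_div_cos, mul_div_assoc]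

/-- The pointwise sum of the generating series under the integral sign. -/
lemma hasSum_cos_mul_tan_sub (x θ : ℝ) {t : ℝ} (ht : |t| < 1) :
    HasSum (fun n : ℕ => (-1 : ℝ) ^ n * t ^ n * Real.cos (x * Real.tan θ - 2 * n * θ))
      (Complex.exp (x * ((circleMap 0 1 (2 * θ) - 1) / (circleMap 0 1 (2 * θ) + 1))) *
        (circleMap 0 1 (2 * θ) / (circleMap 0 1 (2 * θ) + t))).re := by
  set z := circleMap 0 1 (2 * θ) with hz
  have hzn : ‖z‖ = 1 := by simp [hz]
  have hz0 : z ≠ 0 := norm_ne_zero_iff.1 (by simp [hzn])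
  have hzt : z + t ≠ 0 := add_ofReal_ne_zero_of_abs_lt_norm (by rwa [hzn])
  have hgeo : HasSum (fun n : ℕ => (-t * z⁻¹ : ℂ) ^ n) (z / (z + t)) := by
    have := hasSum_geometric_of_norm_lt_one (ξ := (-t * z⁻¹ : ℂ)) (by simpa [hzn] using ht)
    have heq : (1 - -t * z⁻¹ : ℂ)⁻¹ = z / (z + t) := by
      rw [inv_eq_iff_eq_inv, inv_div]
      field_simp
      ring
    rwa [heq] at this
  have hsum := Complex.hasSum_re
    (hgeo.mul_left (Complex.exp (x * ((z - 1) / (z + 1)))))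
  convert hsum using 2 with n
  have hexp : Complex.exp (x * ((z - 1) / (z + 1))) * (-t * z⁻¹ : ℂ) ^ n =
      (((-1) ^ n * t ^ n : ℝ) : ℂ) *
        Complex.exp ((x * Real.tan θ - 2 * n * θ : ℝ) * Complex.I) := by
    have hzi : z⁻¹ ^ n = Complex.exp (-(2 * n * θ * Complex.I)) := by
      rw [hz, circleMap, zero_add, Complex.ofReal_one, one_mul, ← Complex.exp_neg,
        ← Complex.exp_nat_mul]
      push_cast
      ring_nf
    rw [mul_pow, hzi, ← I_mul_tan_eq_cayley, mul_left_comm, ← Complex.exp_add]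
    push_cast
    rw [← mul_pow]
    ring_nf
  rw [hexp, Complex.re_ofReal_mul, Complex.exp_ofReal_mul_I_re]

lemma circleMap_two_mul_pi_sub (θ : ℝ) :
    circleMap 0 1 (2 * (Real.pi - θ)) = (starRingEnd ℂ) (circleMap 0 1 (2 * θ)) := by
  simp only [circleMap, zero_add, Complex.ofReal_one, one_mul, ← Complex.exp_conj, map_mul,
    Complex.conj_I, Complex.conj_ofReal]
  rw [← Complex.exp_periodic.sub_eq]
  push_cast
  ring_nf

lemma integral_re_exp_cayley {x t : ℝ} (hx : 0 ≤ x) (ht : |t| < 1) :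
    ∫ θ in (0 : ℝ)..(Real.pi / 2),
      (Complex.exp (x * ((circleMap 0 1 (2 * θ) - 1) / (circleMap 0 1 (2 * θ) + 1))) *
        (circleMap 0 1 (2 * θ) / (circleMap 0 1 (2 * θ) + t))).re =
      Real.pi / 2 * Real.exp (-x * (1 + t) / (1 - t)) := by
  set f : ℝ → ℂ := fun φ =>
    Complex.exp (x * ((circleMap 0 1 φ - 1) / (circleMap 0 1 φ + 1))) *
      (circleMap 0 1 φ / (circleMap 0 1 φ + t)) with hf
  change ∫ θ in (0 : ℝ)..(Real.pi / 2), (f (2 * θ)).re = _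
  have hbound : ∀ φ, ‖f φ‖ ≤ 1 / (1 - |t|) := by
    intro φ
    have hn : ‖circleMap 0 1 φ‖ = 1 := by simp
    have hlow : 1 - |t| ≤ ‖circleMap 0 1 φ + t‖ := by
      have := norm_sub_le_norm_add (circleMap 0 1 φ) (t : ℂ)
      rwa [hn, Complex.norm_real, Real.norm_eq_abs] at this
    rw [hf, norm_mul, norm_div, hn]
    calc _ ≤ 1 * (1 / (1 - |t|)) := by
          refine mul_le_mul (norm_exp_cayley_le_one hx hn.le) ?_ (by positivity) zero_le_one
          exact div_le_div₀ zero_le_one le_rfl (sub_pos.2 ht) hlow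
      _ = _ := one_mul _
  have hmeas : Measurable f := by
    have : Measurable (circleMap 0 1) := (continuous_circleMap 0 1).measurable
    fun_prop
  have hint : ∀ a b : ℝ, IntervalIntegrable (fun θ => f (2 * θ)) MeasureTheory.volume a b := by
    intro a b
    refine (intervalIntegrable_const (c := 1 / (1 - |t|))).mono_fun
      (hmeas.comp (measurable_const_mul 2)).aestronglyMeasurable
      (Filter.Eventually.of_forall fun θ => ?_)
    exact (hbound _).trans (Real.le_norm_self _)
  have hintre : ∀ a b : ℝ,
      IntervalIntegrable (fun θ => (f (2 * θ)).re) MeasureTheory.volume a b := fun a b =>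
    ⟨(hint a b).1.re, (hint a b).2.re⟩
  have hsymm : ∀ θ, (f (2 * (Real.pi - θ))).re = (f (2 * θ)).re := by
    intro θ
    rw [← Complex.conj_re (f (2 * θ))]
    simp only [hf, circleMap_two_mul_pi_sub, map_mul, map_div₀, map_add, map_sub, map_one,
      ← Complex.exp_conj, Complex.conj_ofReal]
  have hfull : ∫ θ in (0 : ℝ)..Real.pi, f (2 * θ) =
      (Real.pi * Real.exp (-x * (1 + t) / (1 - t)) : ℝ) := by
    rw [intervalIntegral.integral_comp_mul_left f two_ne_zero, mul_zero,
      integral_exp_cayley_circleMap hx ht]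
    have harg : (x * ((-t - 1) / (-t + 1)) : ℂ) = ((-x * (1 + t) / (1 - t) : ℝ) : ℂ) := by
      push_cast
      rw [← mul_div_assoc]
      ring_nf
    rw [harg, Complex.real_smul]
    push_cast
    ring
  have hre : ∫ θ in (0 : ℝ)..Real.pi, (f (2 * θ)).re =
      Real.pi * Real.exp (-x * (1 + t) / (1 - t)) := by
    have h := Complex.reCLM.intervalIntegral_comp_comm (hint 0 Real.pi)
    rw [hfull] at h
    exact h
  have hhalf : ∫ θ in (Real.pi / 2)..Real.pi, (f (2 * θ)).re =
      ∫ θ in (0 : ℝ)..(Real.pi / 2), (f (2 * θ)).re := by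
    have h := intervalIntegral.integral_comp_sub_left (a := 0) (b := Real.pi / 2)
      (fun θ => (f (2 * θ)).re) Real.pi
    rw [sub_half, sub_zero] at h
    rw [← h]
    simp only [hsymm]
  have hadd := intervalIntegral.integral_add_adjacent_intervals
    (hintre 0 (Real.pi / 2)) (hintre (Real.pi / 2) Real.pi)
  rw [hhalf, hre] at hadd
  linarith

theorem bateman_generating_function (x t : ℝ) (hx : 0 < x) (ht : |t| < 1) :
    HasSum (fun n : ℕ => (-1 : ℝ) ^ n * t ^ n * batemanK (2 * n) x)
      (Real.exp (-x * (1 + t) / (1 - t))) := by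
  have hsum := intervalIntegral.hasSum_integral_of_dominated_convergence
    (μ := MeasureTheory.volume) (a := 0) (b := Real.pi / 2)
    (F := fun (n : ℕ) (θ : ℝ) =>
      (-1 : ℝ) ^ n * t ^ n * Real.cos (x * Real.tan θ - 2 * n * θ))
    (fun n _ => |t| ^ n)
    (fun n => by
      have : Measurable Real.tan := by
        simp only [funext Real.tan_eq_sin_div_cos]
        fun_prop
      exact Measurable.aestronglyMeasurable (by fun_prop))
    (fun n => Filter.Eventually.of_forall fun θ _ => by
      rw [norm_mul, norm_mul, norm_pow, norm_pow, norm_neg, norm_one, one_pow, one_mul]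
      exact mul_le_of_le_one_right (by positivity) (Real.abs_cos_le_one _))
    (Filter.Eventually.of_forall fun _ _ => summable_geometric_of_lt_one (abs_nonneg t) ht)
    intervalIntegrable_const
    (Filter.Eventually.of_forall fun θ _ => hasSum_cos_mul_tan_sub x θ ht)
  rw [integral_re_exp_cayley hx.le ht] at hsum
  have hterm : (fun n : ℕ => (-1 : ℝ) ^ n * t ^ n * batemanK (2 * n) x) = fun n : ℕ =>
      2 / Real.pi * ∫ θ in (0 : ℝ)..(Real.pi / 2),
        (-1 : ℝ) ^ n * t ^ n * Real.cos (x * Real.tan θ - 2 * n * θ) := by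
    ext n
    rw [intervalIntegral.integral_const_mul, batemanK]
    ring
  have hval : Real.exp (-x * (1 + t) / (1 - t)) =
      2 / Real.pi * (Real.pi / 2 * Real.exp (-x * (1 + t) / (1 - t))) := by
    have := Real.pi_ne_zero
    field_simp
  rw [hterm, hval]
  exact hsum.mul_left (2 / Real.pi)
end

section
/- For every x > 0 and every real t with |t| < 1, the following two series converge with the stated sums: Σ_{n=0}^∞ (−1)^n t^{2n+1} k_{4n+2}(x) = e^{x(t²−1)/(1+t²)} · sin(2xt/(1+t²)) and Σ_{n=0}^∞ (−1)^n t^{2n} k_{4n}(x) = e^{x(t²−1)/(1+t²)} · cos(2xt/(1+t²)). -/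
open Complex Set Filter Topology MeasureTheory Metric

/-- The generating function `z ↦ exp (x (z - 1) / (z + 1))` of the Bateman functions of even
order. -/
noncomputable def batemanGen (x : ℝ) (z : ℂ) : ℂ :=
  cexp (x * ((z - 1) / (z + 1)))

theorem add_one_ne_zero_of_norm_lt_one {z : ℂ} (hz : ‖z‖ < 1) : z + 1 ≠ 0 := by
  intro h
  rw [eq_neg_of_add_eq_zero_left h] at hz
  simp at hz

theorem norm_batemanGen_le_one {x : ℝ} (hx : 0 < x) {z : ℂ} (hz : ‖z‖ < 1) :
    ‖batemanGen x z‖ ≤ 1 := by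
  rw [batemanGen, Complex.norm_exp, Real.exp_le_one_iff, Complex.re_ofReal_mul]
  refine mul_nonpos_of_nonneg_of_nonpos hx.le ?_
  rw [Complex.div_re, ← add_div]
  refine div_nonpos_of_nonpos_of_nonneg ?_ (Complex.normSq_nonneg _)
  have h : z.re * z.re + z.im * z.im < 1 := by
    rw [← Complex.normSq_apply, Complex.normSq_eq_norm_sq]
    nlinarith [norm_nonneg z]
  simp only [sub_re, one_re, add_re, sub_im, one_im, add_im]
  nlinarith

theorem differentiableAt_batemanGen (x : ℝ) {z : ℂ} (hz : z + 1 ≠ 0) :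
    DifferentiableAt ℂ (batemanGen x) z := by
  unfold batemanGen
  fun_prop (disch := assumption)

theorem differentiableOn_batemanGen (x : ℝ) :
    DifferentiableOn ℂ (batemanGen x) (ball 0 1) := fun z hz =>
  (differentiableAt_batemanGen x
    (add_one_ne_zero_of_norm_lt_one (by simpa using hz))).differentiableWithinAt

theorem batemanGen_exp (x φ : ℝ) :
    batemanGen x (cexp (φ * I)) = cexp ((x * Real.tan (φ / 2) : ℝ) * I) := by
  have key : (cexp (φ * I) - 1) / (cexp (φ * I) + 1) = (Real.tan (φ / 2) : ℝ) * I := by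
    have h1 : cexp (φ * I) = cexp ((φ / 2 : ℝ) * I) * cexp ((φ / 2 : ℝ) * I) := by
      rw [← Complex.exp_add]; congr 1; push_cast; ring
    have hsc : (Real.sin (φ / 2) : ℂ) ^ 2 + (Real.cos (φ / 2) : ℂ) ^ 2 = 1 := by
      exact_mod_cast Real.sin_sq_add_cos_sq (φ / 2)
    have h2 : cexp ((φ / 2 : ℝ) * I) = Real.cos (φ / 2) + Real.sin (φ / 2) * I := by
      rw [Complex.exp_mul_I, Complex.ofReal_cos, Complex.ofReal_sin]
    have hne : cexp ((φ / 2 : ℝ) * I) ≠ 0 := Complex.exp_ne_zero _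
    have hn : cexp (φ * I) - 1 = cexp ((φ / 2 : ℝ) * I) * (2 * (Real.sin (φ / 2) * I)) := by
      rw [h1, h2]
      linear_combination hsc - (Real.sin (φ / 2) : ℂ) ^ 2 * I_sq
    have hd : cexp (φ * I) + 1 = cexp ((φ / 2 : ℝ) * I) * (2 * Real.cos (φ / 2)) := by
      rw [h1, h2]
      linear_combination -hsc + (Real.sin (φ / 2) : ℂ) ^ 2 * I_sq
    rw [hn, hd, mul_div_mul_left _ _ hne, mul_div_mul_left _ _ two_ne_zero,
      Real.tan_eq_sin_div_cos, Complex.ofReal_div]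
    ring
  rw [batemanGen, key]
  push_cast
  ring_nf

theorem integral_batemanGen_circle (x : ℝ) (n : ℕ) {r : ℝ} (hr0 : 0 < r) (hr1 : r < 1) :
    ∫ φ in (0 : ℝ)..2 * Real.pi, cexp (-(n * φ) * I) * batemanGen x (r * cexp (φ * I)) =
      r ^ n * (2 * Real.pi / n.factorial * iteratedDeriv n (batemanGen x) 0) := by
  have h := DifferentiableOn.circleIntegral_one_div_sub_center_pow_smul hr0 n
    ((differentiableOn_batemanGen x).mono (closedBall_subset_ball hr1))
  have hr : (r : ℂ) ≠ 0 := by exact_mod_cast hr0.ne'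
  have h2 : ∮ z in C(0, r), (1 / (z - 0) ^ (n + 1)) • batemanGen x z =
      ∫ φ in (0 : ℝ)..2 * Real.pi,
        (I / r ^ n) * (cexp (-(n * φ) * I) * batemanGen x (r * cexp (φ * I))) := by
    unfold circleIntegral
    congr 1
    ext φ
    have he : cexp (φ * I) ≠ 0 := Complex.exp_ne_zero _
    have : cexp (-(n * φ) * I) = (cexp (φ * I) ^ n)⁻¹ := by
      rw [← Complex.exp_nat_mul, ← Complex.exp_neg]; congr 1; ring
    rw [this, deriv_circleMap]
    simp only [circleMap, zero_add, sub_zero, smul_eq_mul, mul_pow]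
    field_simp
    ring
  rw [h2, intervalIntegral.integral_const_mul, smul_eq_mul] at h
  have hI := I_ne_zero
  have hrn : (r : ℂ) ^ n ≠ 0 := pow_ne_zero _ hr
  field_simp at h ⊢
  linear_combination h

theorem integral_batemanGen_boundary {x : ℝ} (hx : 0 < x) (n : ℕ) :
    ∫ φ in (0 : ℝ)..2 * Real.pi, cexp (-(n * φ) * I) * batemanGen x (cexp (φ * I)) =
      2 * Real.pi / n.factorial * iteratedDeriv n (batemanGen x) 0 := by
  have hmem : ∀ᶠ r : ℝ in 𝓝[<] 1, 0 < r ∧ r < 1 :=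
    Ioo_mem_nhdsLT one_pos
  have hlt : ∀ {r : ℝ}, 0 < r ∧ r < 1 → ∀ φ : ℝ, ‖(r : ℂ) * cexp (φ * I)‖ < 1 := by
    intro r hr φ
    rw [norm_mul, Complex.norm_exp_ofReal_mul_I, mul_one, Complex.norm_real,
      Real.norm_of_nonneg hr.1.le]
    exact hr.2
  have hid : Tendsto (fun r : ℝ => (r : ℂ)) (𝓝[<] 1) (𝓝 1) := by
    have := (Complex.continuous_ofReal.tendsto 1).mono_left (nhdsWithin_le_nhds (s := Iio 1))
    simpa using this
  have hL : Tendsto (fun r : ℝ => ∫ φ in (0 : ℝ)..2 * Real.pi,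
      cexp (-(n * φ) * I) * batemanGen x (r * cexp (φ * I))) (𝓝[<] 1)
      (𝓝 (∫ φ in (0 : ℝ)..2 * Real.pi, cexp (-(n * φ) * I) * batemanGen x (cexp (φ * I)))) := by
    refine intervalIntegral.tendsto_integral_filter_of_dominated_convergence (fun _ => 1)
      ?_ ?_ intervalIntegrable_const ?_
    · filter_upwards [hmem] with r hr
      refine Continuous.aestronglyMeasurable ?_
      have : Continuous fun φ : ℝ => batemanGen x (r * cexp (φ * I)) := by
        refine continuous_iff_continuousAt.2 fun φ => ?_
        exact ContinuousAt.comp (g := batemanGen x) (differentiableAt_batemanGen x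
          (add_one_ne_zero_of_norm_lt_one (hlt hr φ))).continuousAt (by fun_prop)
      fun_prop
    · filter_upwards [hmem] with r hr
      refine Eventually.of_forall fun φ _ => ?_
      have h1 : ‖cexp (-(n * φ) * I)‖ = 1 := by
        have := Complex.norm_exp_ofReal_mul_I (-(n * φ))
        push_cast at this
        exact this
      rw [norm_mul, h1, one_mul]
      exact norm_batemanGen_le_one hx (hlt hr φ)
    · have hne : ∀ᵐ φ : ℝ, φ ≠ Real.pi := by
        simp [ae_iff, measure_singleton]
      filter_upwards [hne] with φ hφ hmemφ
      rw [uIoc_of_le Real.two_pi_pos.le] at hmemφ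
      have hz : cexp (φ * I) + 1 ≠ 0 := by
        intro h
        have h1 : Real.cos φ = -1 := by
          have := congrArg Complex.re (eq_neg_of_add_eq_zero_left h)
          simpa [Complex.exp_ofReal_mul_I_re] using this
        obtain ⟨k, hk⟩ := (Real.cos_eq_neg_one_iff (x := φ)).1 h1
        have hpi := Real.pi_pos
        have hk0 : k = 0 := by
          have h2 : (-1 : ℝ) < k := by
            by_contra! hc
            nlinarith [hmemφ.1]
          have h3 : (k : ℝ) < 1 := by
            by_contra! hc
            nlinarith [hmemφ.2]
          have h2' : (-1 : ℤ) < k := by exact_mod_cast h2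
          have h3' : k < (1 : ℤ) := by exact_mod_cast h3
          omega
        apply hφ
        rw [← hk, hk0]
        simp
      refine Tendsto.const_mul _ ?_
      refine (differentiableAt_batemanGen x hz).continuousAt.tendsto.comp ?_
      simpa using hid.mul_const (cexp (φ * I))
  have hR : Tendsto (fun r : ℝ => (r : ℂ) ^ n *
      (2 * Real.pi / n.factorial * iteratedDeriv n (batemanGen x) 0)) (𝓝[<] 1)
      (𝓝 (2 * Real.pi / n.factorial * iteratedDeriv n (batemanGen x) 0)) := by
    simpa using (hid.pow n).mul_const
      (2 * Real.pi / n.factorial * iteratedDeriv n (batemanGen x) 0 : ℂ)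
  refine tendsto_nhds_unique (hL.congr' ?_) hR
  filter_upwards [hmem] with r hr
  exact integral_batemanGen_circle x n hr.1 hr.2

theorem integral_batemanGen_eq_batemanK (x : ℝ) (n : ℕ) :
    ∫ φ in (0 : ℝ)..2 * Real.pi, cexp (-(n * φ) * I) * batemanGen x (cexp (φ * I)) =
      2 * Real.pi * batemanK (2 * n) x := by
  set p : ℝ → ℝ := fun θ => x * Real.tan θ - 2 * n * θ with hp
  have hpm : Measurable p := by
    have : Measurable Real.tan := by
      have h : Real.tan = fun θ => Real.sin θ / Real.cos θ := funext Real.tan_eq_sin_div_cos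
      rw [h]; fun_prop
    fun_prop
  have hpneg : ∀ θ, p (-θ) = -p θ := fun θ => by simp only [hp, Real.tan_neg]; ring
  have hint : ∀ a b, IntervalIntegrable (fun θ => cexp (p θ * I)) volume a b := by
    intro a b
    refine (intervalIntegrable_const (c := (1 : ℝ))).mono_fun ?_ ?_
    · exact (by fun_prop : Measurable fun θ => cexp (p θ * I)).aestronglyMeasurable
    · exact Eventually.of_forall fun θ => by simp [Complex.norm_exp_ofReal_mul_I]
  have hform : ∀ φ : ℝ, cexp (-(n * φ) * I) * batemanGen x (cexp (φ * I)) =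
      cexp (p (φ / 2) * I) := by
    intro φ
    rw [batemanGen_exp, ← Complex.exp_add]
    congr 1
    simp only [hp]
    push_cast
    ring
  have hper : Function.Periodic
      (fun φ : ℝ => cexp (-(n * φ) * I) * batemanGen x (cexp (φ * I))) (2 * Real.pi) := by
    intro φ
    have h1 : cexp (((φ + 2 * Real.pi : ℝ) : ℂ) * I) = cexp (φ * I) := by
      push_cast
      rw [add_mul, Complex.exp_add, Complex.exp_two_pi_mul_I, mul_one]
    have h2 : ∀ ψ : ℝ, cexp (-(n * ψ) * I) = (cexp (ψ * I) ^ n)⁻¹ := by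
      intro ψ
      rw [← Complex.exp_nat_mul, ← Complex.exp_neg]; congr 1; ring
    simp only [h2, h1]
  have hshift := hper.intervalIntegral_add_eq 0 (-Real.pi)
  rw [zero_add, show -Real.pi + 2 * Real.pi = Real.pi by ring] at hshift
  rw [hshift]
  simp_rw [hform]
  rw [intervalIntegral.integral_comp_div (fun θ => cexp (p θ * I)) two_ne_zero,
    ← intervalIntegral.integral_add_adjacent_intervals (hint _ 0) (hint 0 _)]
  have hneg : ∫ θ in (-Real.pi / 2)..0, cexp (p θ * I) =
      ∫ θ in (0 : ℝ)..Real.pi / 2, cexp (p (-θ) * I) := by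
    rw [intervalIntegral.integral_comp_neg (fun θ => cexp (p θ * I)), neg_zero, neg_div]
  have hint' : IntervalIntegrable (fun θ => cexp (p (-θ) * I)) volume 0 (Real.pi / 2) := by
    simpa using (hint 0 (-(Real.pi / 2))).comp_sub_left 0
  rw [hneg, ← intervalIntegral.integral_add hint' (hint _ _)]
  have hcos : ∀ θ, cexp (p (-θ) * I) + cexp (p θ * I) = ((2 * Real.cos (p θ) : ℝ) : ℂ) := by
    intro θ
    rw [hpneg]
    push_cast
    rw [Complex.two_cos]
    ring
  simp_rw [hcos]
  rw [intervalIntegral.integral_ofReal, intervalIntegral.integral_const_mul, batemanK]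
  have hpi : (Real.pi : ℂ) ≠ 0 := by exact_mod_cast Real.pi_ne_zero
  simp only [hp, Complex.real_smul]
  push_cast
  field_simp

theorem hasSum_batemanGen {x : ℝ} (hx : 0 < x) {z : ℂ} (hz : ‖z‖ < 1) :
    HasSum (fun n : ℕ => z ^ n * batemanK (2 * n) x) (batemanGen x z) := by
  have h := Complex.hasSum_taylorSeries_on_ball (differentiableOn_batemanGen x)
    (z := z) (by simpa using hz)
  refine (funext fun n => ?_ : (fun n : ℕ => z ^ n * (batemanK (2 * n) x : ℂ)) = _) ▸ h
  have hn := (integral_batemanGen_eq_batemanK x n).symm.trans (integral_batemanGen_boundary hx n)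
  have hpi : (Real.pi : ℂ) ≠ 0 := by exact_mod_cast Real.pi_ne_zero
  have hb : (batemanK (2 * n) x : ℂ) = (n.factorial : ℂ)⁻¹ * iteratedDeriv n (batemanGen x) 0 := by
    apply mul_left_cancel₀ (mul_ne_zero two_ne_zero hpi)
    rw [hn]
    ring
  rw [hb, smul_eq_mul, smul_eq_mul, sub_zero]
  ring

theorem batemanGen_I_mul (x t : ℝ) :
    batemanGen x (I * t) =
      cexp ((x * (t ^ 2 - 1) / (1 + t ^ 2) : ℝ) + (2 * x * t / (1 + t ^ 2) : ℝ) * I) := by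
  have h : (1 + t ^ 2 : ℂ) ≠ 0 := by
    have : (1 + t ^ 2 : ℝ) ≠ 0 := by positivity
    exact_mod_cast this
  have h1 : (I * t + 1) * (1 - I * t) = 1 + t ^ 2 := by linear_combination -(t : ℂ) ^ 2 * I_sq
  have h2 : I * t + 1 ≠ 0 := left_ne_zero_of_mul (h1 ▸ h)
  rw [batemanGen]
  congr 1
  push_cast
  field_simp
  linear_combination (-2 * (x : ℂ) * (t : ℂ) ^ 2) * I_sq

theorem bateman_series_trig (x t : ℝ) (hx : 0 < x) (ht : |t| < 1) :
    HasSum (fun n : ℕ => (-1 : ℝ) ^ n * t ^ (2 * n + 1) * batemanK (4 * n + 2) x)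
      (Real.exp (x * (t ^ 2 - 1) / (1 + t ^ 2)) * Real.sin (2 * x * t / (1 + t ^ 2))) ∧
    HasSum (fun n : ℕ => (-1 : ℝ) ^ n * t ^ (2 * n) * batemanK (4 * n) x)
      (Real.exp (x * (t ^ 2 - 1) / (1 + t ^ 2)) * Real.cos (2 * x * t / (1 + t ^ 2))) := by
  have h := hasSum_batemanGen hx (z := I * t) (by simpa using ht)
  rw [batemanGen_I_mul] at h
  have heven : ∀ n : ℕ, (I * t) ^ (2 * n) = (((-1) ^ n * t ^ (2 * n) : ℝ) : ℂ) := by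
    intro n
    rw [mul_pow, pow_mul I, I_sq]
    push_cast
    rfl
  have hodd : ∀ n : ℕ, (I * t) ^ (2 * n + 1) = (((-1) ^ n * t ^ (2 * n + 1) : ℝ) : ℂ) * I := by
    intro n
    rw [mul_pow, pow_succ I, pow_mul I, I_sq]
    push_cast
    ring
  constructor
  · have him := Complex.hasSum_im h
    rw [Complex.exp_im, add_re, add_im, ofReal_re, ofReal_im, re_ofReal_mul, im_ofReal_mul,
      I_re, I_im, mul_zero, add_zero, zero_add, mul_one] at him
    have hinj : Function.Injective fun n : ℕ => 2 * n + 1 := fun a b hab => by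
      simpa using hab
    rw [← hinj.hasSum_iff] at him
    · convert him using 2 with n
      · simp only [Function.comp_apply]
        rw [hodd, mul_right_comm _ I, ← Complex.ofReal_mul, Complex.im_ofReal_mul, I_im, mul_one]
        push_cast
        ring_nf
    · intro k hk
      obtain ⟨m, rfl | rfl⟩ := Nat.even_or_odd' k
      · rw [heven, ← Complex.ofReal_mul, Complex.ofReal_im]
      · exact absurd ⟨m, rfl⟩ hk
  · have hre := Complex.hasSum_re h
    rw [Complex.exp_re, add_re, add_im, ofReal_re, ofReal_im, re_ofReal_mul, im_ofReal_mul,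
      I_re, I_im, mul_zero, add_zero, zero_add, mul_one] at hre
    have hinj : Function.Injective fun n : ℕ => 2 * n := fun a b hab => by
      simpa using hab
    rw [← hinj.hasSum_iff] at hre
    · convert hre using 2 with n
      · simp only [Function.comp_apply]
        rw [heven, ← Complex.ofReal_mul, Complex.ofReal_re]
        push_cast
        ring_nf
    · intro k hk
      obtain ⟨m, rfl | rfl⟩ := Nat.even_or_odd' k
      · exact absurd ⟨m, rfl⟩ hk
      · rw [hodd, mul_right_comm _ I, ← Complex.ofReal_mul, Complex.re_ofReal_mul, I_re, mul_zero]
end
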